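/- Let Ψ : U_q^-(g) ⊗ U_q^-(g) → B_q(g) be the Q(q)-linear map defined by Ψ(x ⊗ y) = E(x)·L(y), where E : U_q^-(g) → B_q(g) is the Q(q)-algebra homomorphism with E(f_i) = e_i' and L(y) is the operator of left multiplication by y. Then Ψ is bijective. -/

import Mathlib

/- Common setting: a symmetrizable generalized Cartan matrix, the field `𝕂 = ℚ(q)`
(with `q = qv`), quantum integers, the negative half `Uq A` of the quantum group
presented by the `q`-Serre relations, its weight spaces, and the root-lattice pairing. -/

set_option maxHeartbeats 1000000
set_option synthInstance.maxHeartbeats 400000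

noncomputable section

structure GCM (I : Type) where
  c : I → I → ℤ
  d : I → ℤ
  d_pos : ∀ i, 0 < d i
  diag : ∀ i, c i i = 2
  offdiag : ∀ i j, i ≠ j → c i j ≤ 0
  dsymm : ∀ i j, d i * c i j = d j * c j i

abbrev 𝕂 : Type := RatFunc ℚ

/-- The indeterminate `q`. -/
def qv : 𝕂 := RatFunc.X

def qNum (t : 𝕂) (n : ℕ) : 𝕂 := (t ^ n - t⁻¹ ^ n) / (t - t⁻¹)

def qFact (t : 𝕂) (n : ℕ) : 𝕂 := ∏ k ∈ Finset.range n, qNum t (k + 1)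

def qBinom (t : 𝕂) (m k : ℕ) : 𝕂 := qFact t m / (qFact t k * qFact t (m - k))

variable {I : Type} [DecidableEq I]

/-- `q_i = q^{d_i}`. -/
def qd (A : GCM I) (i : I) : 𝕂 := qv ^ A.d i

/-- `ζ_i = 1 - q_i^2`. -/
def ze (A : GCM I) (i : I) : 𝕂 := 1 - qd A i ^ 2

/-- The `q`-Serre element `Σ_{k=0}^{b_{ij}} (-1)^k [b_{ij} choose k]_{q_i} a^k b a^{b_{ij}-k}`
for elements `a, b` of any `𝕂`-algebra, where `b_{ij} = 1 - c_{ij}`. -/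
def serreIn {R : Type} [Ring R] [Algebra 𝕂 R] (A : GCM I) (i j : I) (a b : R) : R :=
  ∑ k ∈ Finset.range ((1 - A.c i j).toNat + 1),
    ((-1 : 𝕂) ^ k * qBinom (qd A i) ((1 - A.c i j).toNat) k) •
      (a ^ k * b * a ^ ((1 - A.c i j).toNat - k))

/-- The `q`-Serre relations. -/
inductive URel (A : GCM I) : FreeAlgebra 𝕂 I → FreeAlgebra 𝕂 I → Prop
  | serre (i j : I) (h : i ≠ j) :
      URel A (serreIn A i j (FreeAlgebra.ι 𝕂 i) (FreeAlgebra.ι 𝕂 j)) 0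

/-- The negative half `U_q^-(g)`. -/
abbrev Uq (A : GCM I) : Type := RingQuot (URel A)

/-- The generator `f_i` of `U_q^-(g)`. -/
def fg (A : GCM I) (i : I) : Uq A :=
  RingQuot.mkAlgHom 𝕂 (URel A) (FreeAlgebra.ι 𝕂 i)

/-- The symmetric bilinear pairing on the root lattice, `(α_i, α_j) = d_i c_{ij}`. -/
def ip (A : GCM I) (β γ : I →₀ ℤ) : ℤ :=
  β.sum fun i a => γ.sum fun j b => a * b * (A.d i * A.c i j)

/-- The simple root `α_i` as an element of the root lattice. -/
def sr (i : I) : I →₀ ℤ := Finsupp.single i 1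

/-- The weight space of weight `β` of `U_q^-(g)`, where `wt (f_i) = -α_i`. -/
def Uwt (A : GCM I) (β : I →₀ ℤ) : Submodule 𝕂 (Uq A) :=
  Submodule.span 𝕂 {x | ∃ l : List I,
    -((l.map fun i => Finsupp.single i (1 : ℤ)).sum) = β ∧ x = (l.map (fg A)).prod}


open scoped TensorProduct

/-- The quantum boson algebra `B_q(g)`: the subalgebra of `End (U_q^-(g))` generated by the
left-multiplication operators `L (f_i)` and the operators `e_i'`. -/
def Bqg (A : GCM I) (e' : I → Module.End 𝕂 (Uq A)) : Subalgebra 𝕂 (Module.End 𝕂 (Uq A)) :=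
  Algebra.adjoin 𝕂 ((Set.range fun i => LinearMap.mul 𝕂 (Uq A) (fg A i)) ∪ Set.range e')

/-- The map `Ψ : U_q^-(g) ⊗ U_q^-(g) → End (U_q^-(g))`, `Ψ (x ⊗ y) = E(x) ∘ L(y)`. -/
def PsiMap (A : GCM I) (E : Uq A →ₐ[𝕂] Module.End 𝕂 (Uq A)) :
    Uq A ⊗[𝕂] Uq A →ₗ[𝕂] Module.End 𝕂 (Uq A) :=
  TensorProduct.lift ((LinearMap.mul 𝕂 (Module.End 𝕂 (Uq A))).compl₁₂
    E.toLinearMap (LinearMap.mul 𝕂 (Uq A)))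

set_option linter.unusedSectionVars false

section Presentation

theorem serreIn_map {R R' : Type} [Ring R] [Algebra 𝕂 R] [Ring R'] [Algebra 𝕂 R']
    (φ : R →ₐ[𝕂] R') (A : GCM I) (i j : I) (a b : R) :
    φ (serreIn A i j a b) = serreIn A i j (φ a) (φ b) := by
  simp only [serreIn, map_sum, map_smul, map_mul, map_pow]

theorem serreIn_fg (A : GCM I) {i j : I} (h : i ≠ j) :
    serreIn A i j (fg A i) (fg A j) = 0 := by
  rw [fg, fg, ← serreIn_map, RingQuot.mkAlgHom_rel 𝕂 (URel.serre i j h), map_zero]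

/-- Elements satisfying the `q`-Serre relations define a homomorphism from `U_q^-(g)`. -/
def Uq.lift {R : Type} [Ring R] [Algebra 𝕂 R] (A : GCM I) (a : I → R)
    (ha : ∀ i j, i ≠ j → serreIn A i j (a i) (a j) = 0) : Uq A →ₐ[𝕂] R :=
  RingQuot.liftAlgHom 𝕂 ⟨FreeAlgebra.lift 𝕂 a, by
    rintro _ _ ⟨i, j, h⟩
    rw [serreIn_map, FreeAlgebra.lift_ι_apply, FreeAlgebra.lift_ι_apply, ha i j h, map_zero]⟩

theorem Uq.lift_fg {R : Type} [Ring R] [Algebra 𝕂 R] (A : GCM I) (a : I → R)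
    (ha : ∀ i j, i ≠ j → serreIn A i j (a i) (a j) = 0) (i : I) :
    Uq.lift A a ha (fg A i) = a i := by
  rw [Uq.lift, fg, RingQuot.liftAlgHom_mkAlgHom_apply, FreeAlgebra.lift_ι_apply]

/-- The monomial `f_{i_1} ⋯ f_{i_k}`. -/
def word (A : GCM I) (l : List I) : Uq A := (l.map (fg A)).prod

theorem word_nil (A : GCM I) : word A [] = 1 := rfl

theorem word_cons (A : GCM I) (i : I) (l : List I) : word A (i :: l) = fg A i * word A l := by
  simp [word]

theorem word_append (A : GCM I) (l m : List I) : word A (l ++ m) = word A l * word A m := by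
  simp [word]

theorem span_word (A : GCM I) : Submodule.span 𝕂 (Set.range (word A)) = ⊤ := by
  let S : Subalgebra 𝕂 (Uq A) :=
    Submodule.toSubalgebra (Submodule.span 𝕂 (Set.range (word A)))
      (Submodule.subset_span ⟨[], rfl⟩) (by
        intro x y hx hy
        have h := Submodule.mul_mem_mul hx hy
        rw [Submodule.span_mul_span] at h
        refine Submodule.span_mono ?_ h
        rintro _ ⟨_, ⟨l, rfl⟩, _, ⟨m, rfl⟩, rfl⟩
        exact ⟨l ++ m, word_append A l m⟩)
  have hS : ∀ x : FreeAlgebra 𝕂 I, RingQuot.mkAlgHom 𝕂 (URel A) x ∈ S := by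
    intro x
    induction x using FreeAlgebra.induction with
    | grade0 r => rw [AlgHom.commutes]; exact S.algebraMap_mem r
    | grade1 i => exact Submodule.subset_span ⟨[i], by simp [word, fg]⟩
    | mul a b ha hb => rw [map_mul]; exact S.mul_mem ha hb
    | add a b ha hb => rw [map_add]; exact S.add_mem ha hb
  rw [eq_top_iff]
  rintro x -
  obtain ⟨y, rfl⟩ := RingQuot.mkAlgHom_surjective 𝕂 (URel A) x
  exact hS y

theorem Uq.linearMap_ext {A : GCM I} {M : Type*} [AddCommMonoid M] [Module 𝕂 M]
    {φ ψ : Uq A →ₗ[𝕂] M} (h : ∀ l, φ (word A l) = ψ (word A l)) : φ = ψ :=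
  LinearMap.ext_on (span_word A) (by rintro _ ⟨l, rfl⟩; exact h l)

theorem Uq.induction {A : GCM I} {p : Uq A → Prop} (word : ∀ l, p (word A l))
    (add : ∀ x y, p x → p y → p (x + y)) (smul : ∀ (c : 𝕂) x, p x → p (c • x)) (x : Uq A) :
    p x := by
  have hx : x ∈ Submodule.span 𝕂 (Set.range (_root_.word A)) := by
    rw [span_word]; trivial
  induction hx using Submodule.span_induction with
  | mem x hx => obtain ⟨l, rfl⟩ := hx; exact word l
  | zero => simpa using smul 0 _ (word [])
  | add x y _ _ hx hy => exact add x y hx hy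
  | smul c x _ hx => exact smul c x hx

end Presentation

section Grading

open AddMonoidAlgebra

/-- The weight of a monomial, counted positively. -/
def lwt (l : List I) : I →₀ ℤ := (l.map sr).sum

theorem lwt_cons (i : I) (l : List I) : lwt (i :: l) = sr i + lwt l := by simp [lwt]

theorem serreIn_single {R M : Type} [Ring R] [Algebra 𝕂 R] [AddCommMonoid M]
    (A : GCM I) (i j : I) (α β : M) (a b : R) :
    serreIn A i j (single α a : AddMonoidAlgebra R M) (single β b) =
      single ((1 - A.c i j).toNat • α + β) (serreIn A i j a b) := by
  have hs : ∀ (s : Finset ℕ) (m : M) (f : ℕ → R),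
      (single m (∑ k ∈ s, f k) : AddMonoidAlgebra R M) = ∑ k ∈ s, single m (f k) :=
    fun s m f => map_sum (singleAddHom m) f s
  rw [serreIn, serreIn, hs]
  refine Finset.sum_congr rfl fun k hk => ?_
  rw [single_pow, single_pow, single_mul_single, single_mul_single, smul_single]
  congr 1
  have : k ≤ (1 - A.c i j).toNat := Nat.lt_succ_iff.1 (Finset.mem_range.1 hk)
  conv_rhs => rw [← Nat.add_sub_cancel' this]
  rw [add_smul]
  abel

/-- The homomorphism recording the weight decomposition of `U_q^-(g)`. -/
def weightHom (A : GCM I) : Uq A →ₐ[𝕂] AddMonoidAlgebra (Uq A) (I →₀ ℤ) :=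
  Uq.lift A (fun i => single (sr i) (fg A i)) fun i j h => by
    rw [serreIn_single, serreIn_fg A h, single_zero]

theorem weightHom_word (A : GCM I) (l : List I) :
    weightHom A (word A l) = single (lwt l) (word A l) := by
  induction l with
  | nil => rw [word_nil, map_one]; rfl
  | cons i l ih =>
    rw [word_cons, map_mul, ih, weightHom, Uq.lift_fg, single_mul_single, lwt_cons]

/-- The operator multiplying the component of weight `-β` by `c β`. -/
def scal (A : GCM I) (c : (I →₀ ℤ) → 𝕂) : Uq A →ₗ[𝕂] Uq A where
  toFun x := (weightHom A x).coeff.sum fun β v => c β • v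
  map_add' x y := by
    rw [map_add, coeff_add, Finsupp.sum_add_index'] <;> simp
  map_smul' r x := by
    rw [map_smul, coeff_smul, Finsupp.sum_smul_index' (by simp), RingHom.id_apply,
      Finsupp.smul_sum]
    exact Finset.sum_congr rfl fun β _ => smul_comm _ _ _

theorem scal_word (A : GCM I) (c : (I →₀ ℤ) → 𝕂) (l : List I) :
    scal A c (word A l) = c (lwt l) • word A l := by
  change (weightHom A (word A l)).coeff.sum (fun β v => c β • v) = _
  rw [weightHom_word, coeff_single,
    Finsupp.sum_single_index (h := fun β v => c β • v) (smul_zero _)]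

theorem scal_one (A : GCM I) (c : (I →₀ ℤ) → 𝕂) : scal A c 1 = c 0 • 1 := scal_word A c []

theorem scal_scal (A : GCM I) (c c' : (I →₀ ℤ) → 𝕂) (x : Uq A) :
    scal A c (scal A c' x) = scal A (fun β => c β * c' β) x := by
  revert x
  rw [← funext_iff (f := fun x => scal A c (scal A c' x))]
  refine congrArg DFunLike.coe (Uq.linearMap_ext (φ := scal A c ∘ₗ scal A c') fun l => ?_)
  simp [scal_word, smul_smul, mul_comm]

theorem scal_fg_mul (A : GCM I) (c : (I →₀ ℤ) → 𝕂) (i : I) (x : Uq A) :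
    scal A c (fg A i * x) = fg A i * scal A (fun β => c (sr i + β)) x := by
  induction x using Uq.induction with
  | word l => rw [← word_cons, scal_word, scal_word, lwt_cons, mul_smul_comm, word_cons]
  | add x y hx hy => simp only [mul_add, map_add, hx, hy]
  | smul r x hx => simp only [mul_smul_comm, map_smul, hx]

end Grading

section RootForm

theorem qv_ne_zero : qv ≠ 0 := RatFunc.X_ne_zero

theorem qv_zpow_ne_zero (n : ℤ) : qv ^ n ≠ 0 := zpow_ne_zero n qv_ne_zero

theorem qv_pow_ne_one {n : ℕ} (hn : n ≠ 0) : qv ^ n ≠ 1 := by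
  intro h
  have h' : algebraMap (Polynomial ℚ) 𝕂 (Polynomial.X ^ n) = algebraMap (Polynomial ℚ) 𝕂 1 := by
    rw [map_pow, RatFunc.algebraMap_X, map_one]; exact h
  have h2 := congrArg Polynomial.natDegree (RatFunc.algebraMap_injective ℚ h')
  simp at h2
  exact hn h2

theorem qv_zpow_eq_one {n : ℤ} (h : qv ^ n = 1) : n = 0 := by
  by_contra hn
  obtain ⟨m, rfl | rfl⟩ := n.eq_nat_or_neg
  · exact qv_pow_ne_one (by simpa using hn) (by simpa using h)
  · exact qv_pow_ne_one (n := m) (by simpa using hn) (by simpa using h)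

/-- The functional `(α_i, ·)` on the root lattice. -/
def rf (A : GCM I) (i : I) : (I →₀ ℤ) →+ ℤ :=
  Finsupp.liftAddHom fun j => AddMonoidHom.mulLeft (A.d i * A.c i j)

theorem rf_sr (A : GCM I) (i j : I) : rf A i (sr j) = A.d i * A.c i j := by
  simp [rf, sr]

/-- The pairing on the root lattice as a biadditive map. -/
def bil (A : GCM I) : (I →₀ ℤ) →+ (I →₀ ℤ) →+ ℤ :=
  Finsupp.liftAddHom fun i => (AddMonoidHom.mul (R := ℤ)).compl₂ (rf A i)

theorem bil_sr (A : GCM I) (i : I) (β : I →₀ ℤ) : bil A (sr i) β = rf A i β := by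
  simp [bil, sr]

theorem bil_sr_right (A : GCM I) (i : I) (β : I →₀ ℤ) : bil A β (sr i) = rf A i β := by
  have : (bil A).flip (sr i) = rf A i := by
    ext j
    have h := bil_sr A j (sr i)
    have h' := rf_sr A i j
    rw [rf_sr, A.dsymm] at h
    simpa [sr, h'] using h.trans h'.symm
  exact DFunLike.congr_fun this β

/-- The functional `(ρ, ·)`, where `2 (ρ, α_i) = (α_i, α_i)`. -/
def rhoForm (A : GCM I) : (I →₀ ℤ) →+ ℤ :=
  Finsupp.liftAddHom fun i => AddMonoidHom.mulLeft (A.d i)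

theorem rhoForm_sr (A : GCM I) (i : I) : rhoForm A (sr i) = A.d i := by
  simp [rhoForm, sr]

/-- The exponent `(β, β) / 2 - (ρ, β)`. -/
def gexp (A : GCM I) (β : I →₀ ℤ) : ℤ := (bil A β β - 2 * rhoForm A β) / 2

theorem gexp_zero (A : GCM I) : gexp A 0 = 0 := by simp [gexp]

theorem gexp_sr_add (A : GCM I) (i : I) (β : I →₀ ℤ) :
    gexp A (sr i + β) = gexp A β + rf A i β := by
  have : bil A (sr i + β) (sr i + β) - 2 * rhoForm A (sr i + β) =
      bil A β β - 2 * rhoForm A β + rf A i β * 2 := by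
    simp only [map_add, AddMonoidHom.add_apply, bil_sr, bil_sr_right, rf_sr, rhoForm_sr, A.diag]
    ring
  rw [gexp, this, Int.add_mul_ediv_right _ _ two_ne_zero, gexp]

theorem rhoForm_lwt_nonneg (A : GCM I) (l : List I) : 0 ≤ rhoForm A (lwt l) := by
  induction l with
  | nil => simp [lwt]
  | cons i l ih =>
    rw [lwt_cons, map_add, rhoForm_sr]
    have := A.d_pos i
    omega

/-- A nonzero weight `β` with `(β, β) = 2 (ρ, β)` pairs positively with some simple root. -/
theorem exists_rf_pos (A : GCM I) {l : List I} (hl : l ≠ []) (h : gexp A (lwt l) = 0) :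
    ∃ i, 0 < rf A i (lwt l) := by
  by_contra! hneg
  have hle : ∀ m : List I, bil A (lwt m) (lwt l) ≤ 0 := by
    intro m
    induction m with
    | nil => simp [lwt]
    | cons i m ih =>
      rw [lwt_cons, map_add, AddMonoidHom.add_apply, bil_sr]
      have := hneg i
      omega
  have h1 := hle l
  have h2 : 0 < rhoForm A (lwt l) := by
    cases l with
    | nil => exact absurd rfl hl
    | cons i l =>
      rw [lwt_cons, map_add, rhoForm_sr]
      have := A.d_pos i
      have := rhoForm_lwt_nonneg A l
      omega
  rw [gexp] at h
  omega

end RootForm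

section Operators

/-- The operator acting on weight `-β` by `q^{-(α_i, β)}`. -/
def Kop (A : GCM I) (i : I) : Uq A →ₗ[𝕂] Uq A := scal A fun β => qv ^ (-rf A i β)

/-- The operator acting on weight `-β` by `q^{(α_i, β)}`. -/
def Kinv (A : GCM I) (i : I) : Uq A →ₗ[𝕂] Uq A := scal A fun β => qv ^ rf A i β

theorem scal_smul (A : GCM I) (r : 𝕂) (c : (I →₀ ℤ) → 𝕂) (x : Uq A) :
    scal A (fun β => r * c β) x = r • scal A c x := by
  induction x using Uq.induction with
  | word l => simp only [scal_word, smul_smul]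
  | add x y hx hy => simp only [map_add, hx, hy, smul_add]
  | smul s x hx => rw [map_smul, map_smul, hx, smul_comm]

theorem Kop_fg_mul (A : GCM I) (i j : I) (x : Uq A) :
    Kop A i (fg A j * x) = qv ^ (-(A.d i * A.c i j)) • (fg A j * Kop A i x) := by
  rw [Kop, scal_fg_mul, ← mul_smul_comm, ← scal_smul]
  simp only [map_add, rf_sr, neg_add, zpow_add₀ qv_ne_zero]

theorem Kinv_fg_mul (A : GCM I) (i j : I) (x : Uq A) :
    Kinv A i (fg A j * x) = qv ^ (A.d i * A.c i j) • (fg A j * Kinv A i x) := by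
  rw [Kinv, scal_fg_mul, ← mul_smul_comm, ← scal_smul]
  simp only [map_add, rf_sr, zpow_add₀ qv_ne_zero]

theorem scal_one_fun (A : GCM I) (x : Uq A) : scal A (fun _ => 1) x = x := by
  induction x using Uq.induction with
  | word l => rw [scal_word, one_smul]
  | add x y hx hy => rw [map_add, hx, hy]
  | smul s x hx => rw [map_smul, hx]

theorem Kinv_Kop (A : GCM I) (i : I) (x : Uq A) : Kinv A i (Kop A i x) = x := by
  rw [Kinv, Kop, scal_scal]
  simp only [← zpow_add₀ qv_ne_zero, add_neg_cancel, zpow_zero, scal_one_fun]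

theorem Kop_one (A : GCM I) (i : I) : Kop A i 1 = 1 := by
  simp [Kop, scal_one]

theorem qBinom_symm (t : 𝕂) {m k : ℕ} (h : k ≤ m) : qBinom t m (m - k) = qBinom t m k := by
  rw [qBinom, qBinom, Nat.sub_sub_self h, mul_comm (qFact t (m - k))]

open MulOpposite in
theorem serreIn_op {R : Type} [Ring R] [Algebra 𝕂 R] (A : GCM I) (i j : I) (a b : R) :
    serreIn A i j (op a) (op b) =
      (-1 : 𝕂) ^ (1 - A.c i j).toNat • op (serreIn A i j a b) := by
  rw [serreIn, serreIn, Finset.op_sum, Finset.smul_sum, ← Finset.sum_flip]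
  refine Finset.sum_congr rfl fun k hk => ?_
  have hk : k ≤ (1 - A.c i j).toNat := Nat.lt_succ_iff.1 (Finset.mem_range.1 hk)
  rw [qBinom_symm _ hk, Nat.sub_sub_self hk, op_smul, smul_smul, op_mul, op_mul, op_pow, op_pow,
    ← mul_assoc, ← mul_assoc]
  congr 2
  obtain ⟨n, hn⟩ := Nat.exists_eq_add_of_le hk
  rw [hn, Nat.add_sub_cancel_left, pow_add, mul_right_comm, ← mul_pow]
  simp

/-- The anti-involution of `U_q^-(g)` fixing the generators, as a map to the opposite algebra. -/
def revHom (A : GCM I) : Uq A →ₐ[𝕂] (Uq A)ᵐᵒᵖ :=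
  Uq.lift A (fun i => MulOpposite.op (fg A i)) fun i j h => by
    rw [serreIn_op, serreIn_fg A h, MulOpposite.op_zero, smul_zero]

/-- The anti-involution of `U_q^-(g)` fixing the generators. -/
def rev (A : GCM I) : Uq A →ₗ[𝕂] Uq A :=
  (MulOpposite.opLinearEquiv 𝕂).symm.toLinearMap ∘ₗ (revHom A).toLinearMap

theorem rev_mul (A : GCM I) (x y : Uq A) : rev A (x * y) = rev A y * rev A x := by
  simp [rev]

theorem rev_fg (A : GCM I) (i : I) : rev A (fg A i) = fg A i := by
  simp [rev, revHom, Uq.lift_fg]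

theorem rev_one (A : GCM I) : rev A 1 = 1 := by
  simp [rev]

theorem rev_word (A : GCM I) (l : List I) : rev A (word A l) = word A l.reverse := by
  induction l with
  | nil => exact rev_one A
  | cons i l ih =>
    rw [word_cons, rev_mul, rev_fg, ih, List.reverse_cons, word_append]
    simp [word]

theorem lwt_reverse (l : List I) : lwt l.reverse = lwt l := by
  rw [lwt, lwt, List.map_reverse, List.sum_reverse]

theorem rev_rev (A : GCM I) (x : Uq A) : rev A (rev A x) = x := by
  induction x using Uq.induction with
  | word l => rw [rev_word, rev_word, List.reverse_reverse]
  | add x y hx hy => rw [map_add, map_add, hx, hy]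
  | smul s x hx => rw [map_smul, map_smul, hx]

theorem rev_scal (A : GCM I) (c : (I →₀ ℤ) → 𝕂) (x : Uq A) :
    rev A (scal A c x) = scal A c (rev A x) := by
  induction x using Uq.induction with
  | word l => rw [scal_word, map_smul, rev_word, scal_word, lwt_reverse]
  | add x y hx hy => simp only [map_add, hx, hy]
  | smul s x hx => simp only [map_smul, hx]

end Operators

section Derivations

/-- The operators `e_i'` are characterized by their values on `1` and on products `f_j u`. -/
structure IsBoson (A : GCM I) (e' : I → Module.End 𝕂 (Uq A)) : Prop where
  one : ∀ i, e' i 1 = 0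
  fg_mul : ∀ i j u, e' i (fg A j * u) =
    (if i = j then u else 0) + qv ^ (-(A.d i * A.c i j)) • (fg A j * e' i u)

variable {A : GCM I} {e' : I → Module.End 𝕂 (Uq A)}

/-- The skew derivation `r_i` acting from the right, conjugate to `e_i'` under `rev`. -/
def rder (e' : I → Module.End 𝕂 (Uq A)) (i : I) : Module.End 𝕂 (Uq A) :=
  rev A ∘ₗ e' i ∘ₗ rev A

theorem rder_apply (i : I) (x : Uq A) : rder e' i x = rev A (e' i (rev A x)) := rfl

theorem Uq.induction_cons {p : Uq A → Prop} (one : p 1) (fg_mul : ∀ i x, p x → p (fg A i * x))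
    (add : ∀ x y, p x → p y → p (x + y)) (smul : ∀ (c : 𝕂) x, p x → p (c • x)) (x : Uq A) :
    p x := by
  induction x using Uq.induction with
  | word l =>
    induction l with
    | nil => exact one
    | cons i l ih => rw [word_cons]; exact fg_mul i _ ih
  | add x y hx hy => exact add x y hx hy
  | smul c x hx => exact smul c x hx

theorem IsBoson.mul (h : IsBoson A e') (i : I) (x y : Uq A) :
    e' i (x * y) = e' i x * y + Kop A i x * e' i y := by
  induction x using Uq.induction_cons with
  | one => rw [one_mul, h.one, zero_mul, Kop_one, one_mul, zero_add]
  | fg_mul j x hx =>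
    rw [mul_assoc, h.fg_mul, h.fg_mul, hx, Kop_fg_mul]
    by_cases hij : i = j <;>
      simp [hij, mul_add, add_mul, smul_add, mul_assoc, add_assoc]
  | add x y hx hy => simp only [add_mul, map_add, hx, hy]; abel
  | smul c x hx => simp only [smul_mul_assoc, map_smul, hx, smul_add]

theorem IsBoson.fg (h : IsBoson A e') (i j : I) : e' i (fg A j) = if i = j then 1 else 0 := by
  have := h.fg_mul i j 1
  rwa [mul_one, h.one, mul_zero, smul_zero, add_zero] at this

theorem IsBoson.mul_fg (h : IsBoson A e') (i j : I) (x : Uq A) :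
    e' i (x * _root_.fg A j) = e' i x * _root_.fg A j + if i = j then Kop A i x else 0 := by
  rw [h.mul, h.fg]
  split_ifs <;> simp

theorem IsBoson.scal (h : IsBoson A e') (i : I) (c : (I →₀ ℤ) → 𝕂) (x : Uq A) :
    e' i (scal A c x) = _root_.scal A (fun β => c (sr i + β)) (e' i x) := by
  induction x using Uq.induction_cons generalizing c with
  | one => rw [scal_one, map_smul, h.one, map_zero, smul_zero]
  | fg_mul j x hx =>
    rw [scal_fg_mul, h.fg_mul, h.fg_mul, hx, map_add, map_smul, scal_fg_mul]
    simp only [add_left_comm (sr i)]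
    by_cases hij : i = j <;> simp [hij]
  | add x y hx hy => simp only [map_add, hx, hy]
  | smul s x hx => simp only [map_smul, hx]

theorem rder_one (h : IsBoson A e') (i : I) : rder e' i 1 = 0 := by
  rw [rder_apply, rev_one, h.one, map_zero]

theorem rder_fg_mul (h : IsBoson A e') (i j : I) (x : Uq A) :
    rder e' i (fg A j * x) = fg A j * rder e' i x + if i = j then Kop A i x else 0 := by
  rw [rder_apply, rev_mul, rev_fg, h.mul_fg, map_add, rev_mul, rev_fg, rder_apply]
  split_ifs
  · rw [Kop, rev_scal, rev_rev]
  · rw [map_zero]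

theorem rder_mul_fg (h : IsBoson A e') (i j : I) (x : Uq A) :
    rder e' i (x * fg A j) = (if i = j then x else 0) +
      qv ^ (-(A.d i * A.c i j)) • (rder e' i x * fg A j) := by
  rw [rder_apply, rev_mul, rev_fg, h.fg_mul, map_add, map_smul, rev_mul, rev_fg, rder_apply]
  split_ifs
  · rw [rev_rev]
  · rw [map_zero]

theorem IsBoson.Kop (h : IsBoson A e') (i j : I) (x : Uq A) :
    e' i (Kop A j x) = qv ^ (-(A.d j * A.c j i)) • _root_.Kop A j (e' i x) := by
  rw [_root_.Kop, h.scal, ← scal_smul]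
  simp only [map_add, rf_sr, neg_add, zpow_add₀ qv_ne_zero]

theorem IsBoson.rder_comm (h : IsBoson A e') (i j : I) (x : Uq A) :
    e' j (rder e' i x) = rder e' i (e' j x) := by
  induction x using Uq.induction_cons with
  | one => rw [rder_one h, h.one, map_zero, map_zero]
  | fg_mul k x hx =>
    rw [rder_fg_mul h, map_add, h.fg_mul, h.fg_mul, map_add, map_smul, rder_fg_mul h, hx, smul_add,
      add_assoc]
    by_cases hik : i = k
    · subst hik
      rw [if_pos rfl, if_pos rfl, h.Kop, A.dsymm j i]
      by_cases hjk : j = i <;> simp [hjk]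
    · by_cases hjk : j = k <;> simp [hik, hjk]
  | add x y hx hy => simp only [map_add, hx, hy]
  | smul s x hx => simp only [map_smul, hx]

/-- The span of the monomials of length less than `n`. -/
def lenLT (A : GCM I) (n : ℕ) : Submodule 𝕂 (Uq A) :=
  Submodule.span 𝕂 {x | ∃ l : List I, l.length < n ∧ x = word A l}

theorem word_mem_lenLT {n : ℕ} {l : List I} (hl : l.length < n) : word A l ∈ lenLT A n :=
  Submodule.subset_span ⟨l, hl, rfl⟩

theorem lenLT_mono {m n : ℕ} (h : m ≤ n) : lenLT A m ≤ lenLT A n := by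
  refine Submodule.span_mono ?_
  rintro _ ⟨l, hl, rfl⟩
  exact ⟨l, hl.trans_le h, rfl⟩

theorem lenLT_zero : lenLT A 0 = ⊥ := by simp [lenLT]

theorem exists_mem_lenLT (x : Uq A) : ∃ n, x ∈ lenLT A n := by
  induction x using Uq.induction with
  | word l => exact ⟨l.length + 1, word_mem_lenLT (Nat.lt_succ_self _)⟩
  | add x y hx hy =>
    obtain ⟨m, hm⟩ := hx
    obtain ⟨n, hn⟩ := hy
    exact ⟨max m n, add_mem (lenLT_mono (le_max_left m n) hm) (lenLT_mono (le_max_right m n) hn)⟩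
  | smul c x hx =>
    obtain ⟨m, hm⟩ := hx
    exact ⟨m, Submodule.smul_mem _ c hm⟩

theorem fg_mul_mem_lenLT {n : ℕ} (i : I) {x : Uq A} (hx : x ∈ lenLT A n) :
    fg A i * x ∈ lenLT A (n + 1) := by
  induction hx using Submodule.span_induction with
  | mem x hx =>
    obtain ⟨l, hl, rfl⟩ := hx
    rw [← word_cons]
    exact word_mem_lenLT (by simpa using hl)
  | zero => rw [mul_zero]; exact zero_mem _
  | add x y _ _ hx hy => rw [mul_add]; exact add_mem hx hy
  | smul c x _ hx => rw [mul_smul_comm]; exact Submodule.smul_mem _ c hx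

theorem scal_mem_lenLT {n : ℕ} (c : (I →₀ ℤ) → 𝕂) {x : Uq A} (hx : x ∈ lenLT A n) :
    scal A c x ∈ lenLT A n := by
  induction hx using Submodule.span_induction with
  | mem x hx =>
    obtain ⟨l, hl, rfl⟩ := hx
    rw [scal_word]
    exact Submodule.smul_mem _ _ (word_mem_lenLT hl)
  | zero => rw [map_zero]; exact zero_mem _
  | add x y _ _ hx hy => rw [map_add]; exact add_mem hx hy
  | smul c x _ hx => rw [map_smul]; exact Submodule.smul_mem _ c hx

theorem IsBoson.word_mem_lenLT (h : IsBoson A e') (i : I) (l : List I) :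
    e' i (word A l) ∈ lenLT A l.length := by
  induction l with
  | nil => rw [word_nil, h.one]; exact zero_mem _
  | cons j l ih =>
    rw [word_cons, h.fg_mul]
    refine add_mem ?_ (Submodule.smul_mem _ _ (fg_mul_mem_lenLT j ih))
    split_ifs
    · exact _root_.word_mem_lenLT (by simp)
    · exact zero_mem _

theorem IsBoson.mem_lenLT (h : IsBoson A e') (i : I) {n : ℕ} {x : Uq A}
    (hx : x ∈ lenLT A (n + 1)) : e' i x ∈ lenLT A n := by
  induction hx using Submodule.span_induction with
  | mem x hx =>
    obtain ⟨l, hl, rfl⟩ := hx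
    exact lenLT_mono (Nat.lt_succ_iff.1 hl) (h.word_mem_lenLT i l)
  | zero => rw [map_zero]; exact zero_mem _
  | add x y _ _ hx hy => rw [map_add]; exact add_mem hx hy
  | smul c x _ hx => rw [map_smul]; exact Submodule.smul_mem _ c hx

theorem IsBoson.exists_pow_eq_zero (h : IsBoson A e') (i : I) (x : Uq A) :
    ∃ n, (e' i ^ n) x = 0 := by
  obtain ⟨n, hn⟩ := exists_mem_lenLT x
  refine ⟨n, ?_⟩
  induction n generalizing x with
  | zero => rw [lenLT_zero] at hn; simpa using hn
  | succ n ih => rw [pow_succ, Module.End.mul_apply]; exact ih _ (h.mem_lenLT i hn)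

theorem rder_exists_pow_eq_zero (h : IsBoson A e') (i : I) (x : Uq A) :
    ∃ n, (rder e' i ^ n) x = 0 := by
  obtain ⟨n, hn⟩ := h.exists_pow_eq_zero i (rev A x)
  have : ∀ m, (rder e' i ^ m) x = rev A ((e' i ^ m) (rev A x)) := by
    intro m
    induction m with
    | zero => simp [rev_rev]
    | succ m ih =>
      rw [pow_succ', Module.End.mul_apply, ih, rder_apply, rev_rev, pow_succ',
        Module.End.mul_apply]
  exact ⟨n, by rw [this, hn, map_zero]⟩

end Derivations

section RankOne

theorem Uq.neg_smul (A : GCM I) (c : 𝕂) (x : Uq A) : (-c) • x = -(c • x) := _root_.neg_smul c x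

theorem Uq.sub_smul (A : GCM I) (c d : 𝕂) (x : Uq A) : (c - d) • x = c • x - d • x :=
  _root_.sub_smul c d x

theorem Uq.neg_one_smul (A : GCM I) (x : Uq A) : (-1 : 𝕂) • x = -x := _root_.neg_one_smul 𝕂 x

theorem Uq.neg_mul (A : GCM I) (x y : Uq A) : -x * y = -(x * y) := _root_.neg_mul x y

theorem Uq.mul_neg (A : GCM I) (x y : Uq A) : x * -y = -(x * y) := _root_.mul_neg x y

theorem qd_zpow (A : GCM I) (i : I) (n : ℤ) : qd A i ^ n = qv ^ (A.d i * n) := by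
  rw [qd, zpow_mul]

theorem qd_ne_zero (A : GCM I) (i : I) : qd A i ≠ 0 := qv_zpow_ne_zero _

theorem qv_zpow_sub_inv_ne_zero {n : ℤ} (hn : n ≠ 0) : qv ^ n - (qv ^ n)⁻¹ ≠ 0 := by
  intro h
  have h1 : qv ^ (n + n) = 1 := by
    rw [zpow_add₀ qv_ne_zero]
    nth_rewrite 1 [sub_eq_zero.1 h]
    exact inv_mul_cancel₀ (qv_zpow_ne_zero n)
  have := qv_zpow_eq_one h1
  omega

theorem qFact_ne_zero (A : GCM I) (i : I) (n : ℕ) : qFact (qd A i) n ≠ 0 := by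
  refine Finset.prod_ne_zero_iff.2 fun k _ => div_ne_zero ?_
    (qv_zpow_sub_inv_ne_zero (A.d_pos i).ne')
  rw [inv_pow, ← zpow_natCast, qd_zpow]
  exact qv_zpow_sub_inv_ne_zero (mul_ne_zero (A.d_pos i).ne' (by positivity))

theorem qBinom_self (A : GCM I) (i : I) (n : ℕ) : qBinom (qd A i) n n = 1 := by
  have : qFact (qd A i) 0 = 1 := rfl
  rw [qBinom, Nat.sub_self, this, mul_one, div_self (qFact_ne_zero A i n)]

theorem exists_pow_mul_fg (A : GCM I) {i j : I} (hij : i ≠ j) (m M : ℕ)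
    (hM : m * (1 - A.c i j).toNat ≤ M) : ∃ y, fg A i ^ M * fg A j = y * fg A i ^ m := by
  induction m generalizing M with
  | zero => exact ⟨_, by rw [pow_zero, mul_one]⟩
  | succ m ih =>
    have hs := serreIn_fg A hij
    set b := (1 - A.c i j).toNat with hb
    rw [serreIn, ← hb, Finset.sum_range_succ, qBinom_self, mul_one, Nat.sub_self, pow_zero, mul_one]
      at hs
    have hs' : fg A i ^ b * fg A j = ∑ k ∈ Finset.range b,
        (-((-1 : 𝕂) ^ b) * ((-1 : 𝕂) ^ k * qBinom (qd A i) b k)) •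
          (fg A i ^ k * fg A j * fg A i ^ (b - k)) := by
      simp_rw [mul_smul (-((-1 : 𝕂) ^ b))]
      rw [← Finset.smul_sum, eq_neg_of_add_eq_zero_left hs, smul_neg, Uq.neg_smul, neg_neg,
        smul_smul,
        ← mul_pow, neg_one_mul, neg_neg, one_pow, one_smul]
    have hM' : M = (M - b) + b := by
      have : b ≤ (m + 1) * b := Nat.le_mul_of_pos_left b (Nat.succ_pos m)
      omega
    have hMb : m * b ≤ M - b := by rw [Nat.succ_mul] at hM; omega
    choose y hy using fun k : ℕ => ih (M - b + k) (hMb.trans (Nat.le_add_right _ _))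
    refine ⟨∑ k ∈ Finset.range b, (-((-1 : 𝕂) ^ b) * ((-1 : 𝕂) ^ k * qBinom (qd A i) b k)) •
          (y k * fg A i ^ (b - k - 1)), ?_⟩
    rw [hM', pow_add, mul_assoc, hs', Finset.mul_sum, Finset.sum_mul]
    refine Finset.sum_congr rfl fun k hk => ?_
    have hk' : b - k = (b - k - 1) + 1 := by have := Finset.mem_range.1 hk; omega
    rw [mul_smul_comm, smul_mul_assoc, ← mul_assoc (fg A i ^ (M - b)),
      ← mul_assoc (fg A i ^ (M - b)), ← pow_add, hy, mul_assoc, mul_assoc, ← pow_add, ← pow_add]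
    congr 3
    omega

theorem exists_pow_mul (A : GCM I) (i : I) (x : Uq A) (m : ℕ) :
    ∃ N, ∀ M, N ≤ M → ∃ y, fg A i ^ M * x = y * fg A i ^ m := by
  induction x using Uq.induction_cons generalizing m with
  | one =>
    exact ⟨m, fun M hM => ⟨fg A i ^ (M - m), by rw [mul_one, ← pow_add, Nat.sub_add_cancel hM]⟩⟩
  | fg_mul j x hx =>
    obtain ⟨N, hN⟩ := hx m
    by_cases hij : i = j
    · subst hij
      refine ⟨N, fun M hM => ?_⟩
      rw [← mul_assoc, ← pow_succ]
      exact hN _ (by omega)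
    · refine ⟨N * (1 - A.c i j).toNat, fun M hM => ?_⟩
      obtain ⟨y, hy⟩ := exists_pow_mul_fg A hij N M hM
      obtain ⟨y', hy'⟩ := hN N le_rfl
      exact ⟨y * y', by rw [← mul_assoc, hy, mul_assoc, hy', mul_assoc]⟩
  | add x y hx hy =>
    obtain ⟨N, hN⟩ := hx m
    obtain ⟨N', hN'⟩ := hy m
    refine ⟨max N N', fun M hM => ?_⟩
    obtain ⟨z, hz⟩ := hN M (le_trans (le_max_left _ _) hM)
    obtain ⟨z', hz'⟩ := hN' M (le_trans (le_max_right _ _) hM)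
    exact ⟨z + z', by rw [mul_add, add_mul, hz, hz']⟩
  | smul c x hx =>
    obtain ⟨N, hN⟩ := hx m
    refine ⟨N, fun M hM => ?_⟩
    obtain ⟨z, hz⟩ := hN M hM
    exact ⟨c • z, by rw [mul_smul_comm, hz, smul_mul_assoc]⟩

theorem scal_mul_fg (A : GCM I) (c : (I →₀ ℤ) → 𝕂) (i : I) (x : Uq A) :
    scal A c (x * fg A i) = scal A (fun β => c (sr i + β)) x * fg A i := by
  have h := rev_scal A c (fg A i * rev A x)
  rw [rev_mul, rev_rev, rev_fg] at h
  rw [← h, scal_fg_mul, rev_mul, rev_scal, rev_rev, rev_fg]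

variable {A : GCM I} {e' : I → Module.End 𝕂 (Uq A)}

/-- The element `u` is homogeneous of weight `-β`. -/
def IsHomog (A : GCM I) (β : I →₀ ℤ) (u : Uq A) : Prop := ∀ c, scal A c u = c β • u

/-- The difference of the two skew derivations attached to `i`; together with left
multiplication by `f_i` it generates an action of the rank one quantum group. -/
def adj (A : GCM I) (e' : I → Module.End 𝕂 (Uq A)) (i : I) : Module.End 𝕂 (Uq A) :=
  rder e' i - Kinv A i ∘ₗ e' i

theorem adj_fg_mul (h : IsBoson A e') (i : I) (x : Uq A) :
    adj A e' i (fg A i * x) = fg A i * adj A e' i x + (Kop A i x - Kinv A i x) := by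
  simp only [adj, LinearMap.sub_apply, LinearMap.comp_apply]
  rw [rder_fg_mul h, h.fg_mul, if_pos rfl, if_pos rfl, map_add, map_smul, Kinv_fg_mul, smul_smul,
    ← zpow_add₀ qv_ne_zero, mul_sub]
  rw [neg_add_cancel, zpow_zero, one_smul]
  abel

theorem adj_mul_fg (h : IsBoson A e') (i : I) (x : Uq A) :
    ∃ y, adj A e' i (x * fg A i) = y * fg A i := by
  simp only [adj, LinearMap.sub_apply, LinearMap.comp_apply]
  rw [rder_mul_fg h, h.mul_fg, if_pos rfl, if_pos rfl, map_add, Kinv_Kop, Kinv, scal_mul_fg]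
  refine ⟨qv ^ (-(A.d i * A.c i i)) • rder e' i x -
    scal A (fun β => qv ^ rf A i (sr i + β)) (e' i x), ?_⟩
  rw [sub_mul, smul_mul_assoc]
  abel

theorem IsHomog.fg_mul {β : I →₀ ℤ} {u : Uq A} (hu : IsHomog A β u) (i : I) :
    IsHomog A (sr i + β) (fg A i * u) := fun c => by
  rw [scal_fg_mul, hu, mul_smul_comm]

theorem IsHomog.pow_mul {β : I →₀ ℤ} {u : Uq A} (hu : IsHomog A β u) (i : I) (n : ℕ) :
    IsHomog A (n • sr i + β) (fg A i ^ n * u) := by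
  induction n with
  | zero => simpa using hu
  | succ n ih =>
    rw [pow_succ', mul_assoc, succ_nsmul', add_assoc]
    exact ih.fg_mul i

theorem rank_one_sum {F : Type*} [Field F] (T Q : F) (hT : T ≠ 0) (hQ : Q ≠ 0) (n : ℕ) :
    (Q - Q⁻¹) * ∑ m ∈ Finset.range n, ((T * (Q ^ m) ^ 2)⁻¹ - T * (Q ^ m) ^ 2) =
      -((Q ^ n - (Q ^ n)⁻¹) * (T * Q ^ n * Q⁻¹ - (T * Q ^ n * Q⁻¹)⁻¹)) := by
  induction n with
  | zero => simp
  | succ n ih =>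
    rw [Finset.sum_range_succ, mul_add, ih, pow_succ Q n]
    clear ih
    have hP : Q ^ n ≠ 0 := pow_ne_zero n hQ
    generalize Q ^ n = P at *
    field_simp
    ring

theorem adj_pow_mul (h : IsBoson A e') (i : I) {β : I →₀ ℤ} {u : Uq A} (hu : IsHomog A β u)
    (h0 : adj A e' i u = 0) (n : ℕ) : adj A e' i (fg A i ^ (n + 1) * u) =
      (∑ m ∈ Finset.range (n + 1), ((qv ^ rf A i β * (qd A i ^ m) ^ 2)⁻¹ -
        qv ^ rf A i β * (qd A i ^ m) ^ 2)) • (fg A i ^ n * u) := by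
  have key : ∀ m : ℕ, qv ^ rf A i (m • sr i + β) = qv ^ rf A i β * (qd A i ^ m) ^ 2 := by
    intro m
    rw [map_add, map_nsmul, rf_sr, A.diag, add_comm, zpow_add₀ qv_ne_zero, ← pow_mul,
      ← zpow_natCast, qd_zpow]
    congr 2
    push_cast
    rw [nsmul_eq_mul]
    ring
  have hKK : ∀ m : ℕ, Kop A i (fg A i ^ m * u) - Kinv A i (fg A i ^ m * u) =
      ((qv ^ rf A i β * (qd A i ^ m) ^ 2)⁻¹ - qv ^ rf A i β * (qd A i ^ m) ^ 2) •
        (fg A i ^ m * u) := by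
    intro m
    rw [Kop, Kinv, hu.pow_mul, hu.pow_mul, zpow_neg, key, Uq.sub_smul]
  induction n with
  | zero =>
    rw [pow_succ', mul_assoc, adj_fg_mul h, hKK, pow_zero, one_mul, h0]
    simp
  | succ n ih =>
    rw [pow_succ', mul_assoc, adj_fg_mul h, hKK, ih, Finset.sum_range_succ _ (n + 1), mul_smul_comm,
      ← mul_assoc, ← pow_succ', ← add_smul]

theorem rank_one_sum_ne_zero (A : GCM I) (i : I) {r : ℤ} (hr : 0 < r) (n : ℕ) :
    ∑ m ∈ Finset.range (n + 1), ((qv ^ r * (qd A i ^ m) ^ 2)⁻¹ -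
        qv ^ r * (qd A i ^ m) ^ 2) ≠ 0 := by
  have h := rank_one_sum (qv ^ r) (qd A i) (qv_zpow_ne_zero r) (qd_ne_zero A i) (n + 1)
  have hd := A.d_pos i
  refine right_ne_zero_of_mul (a := qd A i - (qd A i)⁻¹) ?_
  rw [h]
  refine neg_ne_zero.2 (mul_ne_zero ?_ ?_)
  · rw [← zpow_natCast, qd_zpow]
    exact qv_zpow_sub_inv_ne_zero (mul_ne_zero hd.ne' (by positivity))
  · rw [pow_succ, mul_assoc, mul_assoc, mul_inv_cancel₀ (qd_ne_zero A i), mul_one, ← zpow_natCast,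
      qd_zpow, ← zpow_add₀ qv_ne_zero]
    refine qv_zpow_sub_inv_ne_zero ?_
    have : 0 ≤ A.d i * (n : ℤ) := by positivity
    omega

theorem rder_mul_fg_eq_zero (h : IsBoson A e') (i : I) {z : Uq A}
    (hz : rder e' i (z * fg A i) = 0) : z = 0 := by
  set p : 𝕂 := qv ^ (-(A.d i * A.c i i)) with hp
  have hpk : ∀ k : ℕ, ∑ j ∈ Finset.range (k + 1), p ^ j ≠ 0 := by
    intro k hk
    have h1 := geom_sum_mul p (k + 1)
    rw [hk, zero_mul] at h1
    have h2 := (sub_eq_zero.1 h1.symm)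
    rw [hp, ← zpow_natCast, ← zpow_mul] at h2
    have h3 := qv_zpow_eq_one h2
    rw [A.diag] at h3
    have := A.d_pos i
    rcases mul_eq_zero.1 h3 with h4 | h4
    · omega
    · omega
  have hk : ∀ k : ℕ, (∑ j ∈ Finset.range (k + 1), p ^ j) • (rder e' i ^ k) z =
      -(p ^ (k + 1)) • ((rder e' i ^ (k + 1)) z * fg A i) := by
    intro k
    induction k with
    | zero =>
      rw [rder_mul_fg h, if_pos rfl] at hz
      rw [zero_add, pow_one, pow_one, pow_zero, Finset.sum_range_one, pow_zero, one_smul,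
        Uq.neg_smul,
        Module.End.one_apply]
      exact eq_neg_of_add_eq_zero_left hz
    | succ k ih =>
      have h1 := congrArg (rder e' i) ih
      rw [map_smul, map_smul, rder_mul_fg h, if_pos rfl, ← Module.End.mul_apply, ← pow_succ',
        ← Module.End.mul_apply, ← pow_succ', smul_add, smul_smul, ← hp] at h1
      rw [Finset.sum_range_succ, add_smul, h1, neg_mul, ← pow_succ, Uq.neg_smul, add_right_comm,
        neg_add_cancel, zero_add]
  obtain ⟨n, hn⟩ := rder_exists_pow_eq_zero h i z
  induction n with
  | zero => simpa using hn
  | succ n ih =>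
    have := hk n
    rw [hn, zero_mul, smul_zero] at this
    exact ih ((smul_eq_zero.1 this).resolve_left (hpk n))

/-- A homogeneous element killed by both skew derivations attached to `i` vanishes as soon as
its weight pairs positively with `α_i`. -/
theorem eq_zero_of_rf_pos (h : IsBoson A e') {i : I} {β : I →₀ ℤ} {u : Uq A}
    (hu : IsHomog A β u) (h1 : e' i u = 0) (h2 : rder e' i u = 0) (hr : 0 < rf A i β) :
    u = 0 := by
  have h0 : adj A e' i u = 0 := by simp [adj, h1, h2]
  have hn : ∀ n, (∃ y, fg A i ^ n * u = y * fg A i) → ∃ y, u = y * fg A i := by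
    intro n
    induction n with
    | zero => rintro ⟨y, hy⟩; exact ⟨y, by simpa using hy⟩
    | succ n ih =>
      rintro ⟨y, hy⟩
      refine ih ?_
      have h3 := adj_pow_mul h i hu h0 n
      obtain ⟨z, hz⟩ := adj_mul_fg h i y
      rw [hy, hz] at h3
      refine ⟨(∑ m ∈ Finset.range (n + 1), ((qv ^ rf A i β * (qd A i ^ m) ^ 2)⁻¹ -
        qv ^ rf A i β * (qd A i ^ m) ^ 2))⁻¹ • z, ?_⟩
      rw [smul_mul_assoc, h3, smul_smul, inv_mul_cancel₀ (rank_one_sum_ne_zero A i hr n), one_smul]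
  obtain ⟨N, hN⟩ := exists_pow_mul A i u 1
  obtain ⟨z, rfl⟩ := hn N (by simpa using hN N le_rfl)
  rw [rder_mul_fg_eq_zero h i h2, zero_mul]

end RankOne

section Slices

variable {F M N : Type*} [Field F] [AddCommGroup M] [Module F M] [AddCommGroup N] [Module F N]

/-- Contraction of the right tensor factor with a functional. -/
def sliceR (φ : N →ₗ[F] F) : M ⊗[F] N →ₗ[F] M := TensorProduct.rid F M ∘ₗ φ.lTensor M

/-- Contraction of the left tensor factor with a functional. -/
def sliceL (φ : M →ₗ[F] F) : M ⊗[F] N →ₗ[F] N := TensorProduct.lid F N ∘ₗ φ.rTensor N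

@[simp] theorem sliceR_tmul (φ : N →ₗ[F] F) (a : M) (b : N) : sliceR φ (a ⊗ₜ[F] b) = φ b • a := by
  simp [sliceR]

@[simp] theorem sliceL_tmul (φ : M →ₗ[F] F) (a : M) (b : N) : sliceL φ (a ⊗ₜ[F] b) = φ a • b := by
  simp [sliceL]

theorem eq_zero_of_sliceR {z : M ⊗[F] N} (h : ∀ φ, sliceR φ z = 0) : z = 0 := by
  classical
  let b := Module.Basis.ofVectorSpace F N
  refine (TensorProduct.equivFinsuppOfBasisRight (M := M) b).injective ?_
  rw [map_zero]
  ext k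
  have : ∀ w : M ⊗[F] N, TensorProduct.equivFinsuppOfBasisRight (M := M) b w k =
      sliceR (b.coord k) w := by
    intro w
    induction w with
    | zero => simp
    | tmul x y => rw [TensorProduct.equivFinsuppOfBasisRight_apply_tmul_apply]; simp
    | add x y hx hy => rw [map_add, Finsupp.add_apply, hx, hy, map_add]
  rw [this, h]
  rfl

theorem eq_of_sliceR {z w : M ⊗[F] N} (h : ∀ φ, sliceR φ z = sliceR φ w) : z = w :=
  sub_eq_zero.1 (eq_zero_of_sliceR fun φ => by rw [map_sub, h, sub_self])

theorem sliceR_sliceL_comm (φ : M →ₗ[F] F) (ψ : N →ₗ[F] F) (z : M ⊗[F] N) :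
    φ (sliceR ψ z) = ψ (sliceL φ z) := by
  induction z with
  | zero => simp
  | tmul x y => simp [mul_comm]
  | add x y hx hy => simp only [map_add, hx, hy]

end Slices

section Components

variable {A : GCM I}

/-- The height of a weight. -/
def ht : (I →₀ ℤ) →+ ℤ := Finsupp.liftAddHom fun _ => AddMonoidHom.id ℤ

theorem ht_sr (i : I) : ht (sr i) = 1 := by simp [ht, sr]

theorem ht_lwt (l : List I) : ht (lwt l) = l.length := by
  induction l with
  | nil => simp [lwt]
  | cons i l ih => rw [lwt_cons, map_add, ht_sr, ih, List.length_cons]; push_cast; ring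

open Classical in
/-- The component of weight `-β`. -/
def comp (A : GCM I) (β : I →₀ ℤ) : Uq A →ₗ[𝕂] Uq A := scal A fun γ => if γ = β then 1 else 0

open Classical in
theorem comp_word (β : I →₀ ℤ) (l : List I) :
    comp A β (word A l) = if lwt l = β then word A l else 0 := by
  rw [comp, scal_word]
  split_ifs <;> simp

theorem comp_eq_coeff (β : I →₀ ℤ) (x : Uq A) : comp A β x = (weightHom A x).coeff β := by
  classical
  change ((weightHom A x).coeff.sum fun γ v => (if γ = β then (1 : 𝕂) else 0) • v) = _
  rw [Finsupp.sum, Finset.sum_eq_single β]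
  · simp
  · intro b _ hb; simp [hb]
  · intro h; simpa using h

theorem eq_comp_zero {x : Uq A} (h : ∀ β ≠ 0, comp A β x = 0) : x = comp A 0 x := by
  classical
  have h1 : scal A (fun _ => 1) x = comp A 0 x := by
    change ((weightHom A x).coeff.sum fun γ v => (1 : 𝕂) • v) =
      ((weightHom A x).coeff.sum fun γ v => (if γ = 0 then (1 : 𝕂) else 0) • v)
    refine Finset.sum_congr rfl fun β _ => ?_
    by_cases hβ : β = 0
    · simp [hβ]
    · have := h β hβ
      rw [comp_eq_coeff] at this
      simp [this]
  rwa [scal_one_fun] at h1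

theorem isHomog_comp (β : I →₀ ℤ) (x : Uq A) : IsHomog A β (comp A β x) := fun c => by
  rw [comp, scal_scal, ← scal_smul]
  congr 2
  ext γ
  split_ifs with h <;> simp [h]

/-- The augmentation of `U_q^-(g)`. -/
def counit (A : GCM I) : Uq A →ₐ[𝕂] 𝕂 :=
  Uq.lift A (fun _ => 0) fun i j _ => by simp [serreIn]

theorem counit_fg (i : I) : counit A (fg A i) = 0 := by rw [counit, Uq.lift_fg]

theorem counit_fg_mul (i : I) (x : Uq A) : counit A (fg A i * x) = 0 := by
  rw [map_mul, counit_fg, zero_mul]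

theorem counit_scal (c : (I →₀ ℤ) → 𝕂) (x : Uq A) :
    counit A (scal A c x) = c 0 * counit A x := by
  induction x using Uq.induction_cons generalizing c with
  | one => rw [scal_one, map_smul, smul_eq_mul]
  | fg_mul i x _ => rw [scal_fg_mul, counit_fg_mul, counit_fg_mul, mul_zero]
  | add x y hx hy => simp only [map_add, hx, hy, mul_add]
  | smul s x hx => simp only [map_smul, hx, smul_eq_mul, mul_left_comm]

theorem comp_zero (x : Uq A) : comp A 0 x = counit A x • 1 := by
  classical
  induction x using Uq.induction_cons with
  | one => rw [comp, scal_one, map_one]; simp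
  | fg_mul i x hx =>
    clear hx
    rw [counit_fg_mul, zero_smul]
    induction x using Uq.induction with
    | word l =>
      rw [← word_cons, comp_word, if_neg]
      intro h
      have := congrArg ht h
      rw [ht_lwt, List.length_cons, map_zero] at this
      omega
    | add x y hx hy => rw [mul_add, map_add, hx, hy, add_zero]
    | smul s x hx => rw [mul_smul_comm, map_smul, hx, smul_zero]
  | add x y hx hy => simp only [map_add, hx, hy, add_smul]
  | smul s x hx => rw [map_smul, map_smul, hx, smul_smul, smul_eq_mul]

theorem comp_mem_span {β : I →₀ ℤ} {n : ℕ} {x : Uq A} (hx : x ∈ lenLT A n) :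
    comp A β x ∈
      Submodule.span 𝕂 {y | ∃ l : List I, (lwt l = β ∧ l.length < n) ∧ y = word A l} := by
  classical
  induction hx using Submodule.span_induction with
  | mem x hx =>
    obtain ⟨l, hl, rfl⟩ := hx
    rw [comp_word]
    split_ifs with h
    · exact Submodule.subset_span ⟨l, ⟨h, hl⟩, rfl⟩
    · exact zero_mem _
  | zero => rw [map_zero]; exact zero_mem _
  | add x y _ _ hx hy => rw [map_add]; exact add_mem hx hy
  | smul c x _ hx => rw [map_smul]; exact Submodule.smul_mem _ c hx

theorem rev_mem_lenLT {n : ℕ} {x : Uq A} (hx : x ∈ lenLT A n) : rev A x ∈ lenLT A n := by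
  induction hx using Submodule.span_induction with
  | mem x hx =>
    obtain ⟨l, hl, rfl⟩ := hx
    rw [rev_word]
    exact word_mem_lenLT (by simpa using hl)
  | zero => rw [map_zero]; exact zero_mem _
  | add x y _ _ hx hy => rw [map_add]; exact add_mem hx hy
  | smul c x _ hx => rw [map_smul]; exact Submodule.smul_mem _ c hx

theorem rder_mem_lenLT {e' : I → Module.End 𝕂 (Uq A)} (h : IsBoson A e') (i : I) {n : ℕ}
    {x : Uq A} (hx : x ∈ lenLT A (n + 1)) : rder e' i x ∈ lenLT A n :=
  rev_mem_lenLT (h.mem_lenLT i (rev_mem_lenLT hx))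

theorem counit_rder {e' : I → Module.End 𝕂 (Uq A)} (h : IsBoson A e') (i : I) (x : Uq A) :
    counit A (rder e' i x) = counit A (e' i x) := by
  induction x using Uq.induction_cons with
  | one => rw [rder_one h, h.one]
  | fg_mul j x _ =>
    rw [rder_fg_mul h, h.fg_mul, map_add, map_add, map_smul, counit_fg_mul, counit_fg_mul,
      smul_zero, add_zero, zero_add]
    split_ifs
    · rw [Kop, counit_scal, map_zero, neg_zero, zpow_zero, one_mul]
    · rfl
  | add x y hx hy => simp only [map_add, hx, hy]
  | smul s x hx => simp only [map_smul, hx]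

end Components

section Coproduct

variable {A : GCM I} {e' : I → Module.End 𝕂 (Uq A)}

/-- Left multiplication by the coproduct of `f_j`. -/
def copMul (A : GCM I) (j : I) : Uq A ⊗[𝕂] Uq A →ₗ[𝕂] Uq A ⊗[𝕂] Uq A :=
  TensorProduct.map (LinearMap.mulLeft 𝕂 (fg A j)) LinearMap.id +
    TensorProduct.map (Kop A j) (LinearMap.mulLeft 𝕂 (fg A j))

theorem copMul_tmul (j : I) (a b : Uq A) :
    copMul A j (a ⊗ₜ b) = (fg A j * a) ⊗ₜ b + Kop A j a ⊗ₜ (fg A j * b) := rfl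

/-- The coproduct of a monomial. -/
def copWord (A : GCM I) : List I → Uq A ⊗[𝕂] Uq A
  | [] => 1 ⊗ₜ 1
  | j :: l => copMul A j (copWord A l)

/-- The pairs formed by a linear combination of monomials of length `n` and the same
combination of their coproducts. -/
def copGraph (A : GCM I) (n : ℕ) : Submodule 𝕂 (Uq A × Uq A ⊗[𝕂] Uq A) :=
  Submodule.span 𝕂 {p | ∃ l : List I, l.length = n ∧ p = (word A l, copWord A l)}

theorem mem_copGraph (l : List I) : (word A l, copWord A l) ∈ copGraph A l.length :=
  Submodule.subset_span ⟨l, rfl, rfl⟩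

theorem copGraph_le_comap {n : ℕ} {V : Type*} [AddCommMonoid V] [Module 𝕂 V]
    (S : Submodule 𝕂 V) (T : Uq A × Uq A ⊗[𝕂] Uq A →ₗ[𝕂] V)
    (h : ∀ l : List I, l.length = n → T (word A l, copWord A l) ∈ S)
    {p : Uq A × Uq A ⊗[𝕂] Uq A} (hp : p ∈ copGraph A n) : T p ∈ S := by
  have : copGraph A n ≤ S.comap T := by
    refine Submodule.span_le.2 ?_
    rintro _ ⟨l, hl, rfl⟩
    exact h l hl
  exact this hp

theorem copMul_mem {n : ℕ} (j : I) {p : Uq A × Uq A ⊗[𝕂] Uq A} (hp : p ∈ copGraph A n) :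
    (fg A j * p.1, copMul A j p.2) ∈ copGraph A (n + 1) := by
  refine copGraph_le_comap (copGraph A (n + 1))
    ((LinearMap.mulLeft 𝕂 (fg A j)).prodMap (copMul A j)) (fun l hl => ?_) hp
  subst hl
  have := mem_copGraph (A := A) (j :: l)
  rwa [word_cons] at this

theorem IsBoson.rTensor_copMul (h : IsBoson A e') (i j : I) (z : Uq A ⊗[𝕂] Uq A) :
    (e' i).rTensor (Uq A) (copMul A j z) = (if i = j then z else 0) +
      qv ^ (-(A.d i * A.c i j)) • copMul A j ((e' i).rTensor (Uq A) z) := by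
  induction z with
  | zero => simp
  | tmul a b =>
    rw [copMul_tmul, map_add, LinearMap.rTensor_tmul, LinearMap.rTensor_tmul,
      LinearMap.rTensor_tmul, copMul_tmul, h.fg_mul, h.Kop, A.dsymm j i, TensorProduct.add_tmul,
      smul_add, TensorProduct.smul_tmul', TensorProduct.smul_tmul', add_assoc]
    split_ifs <;> simp
  | add x y hx hy =>
    simp only [map_add, hx, hy, smul_add]
    split_ifs
    · abel
    · abel

theorem IsBoson.copGraph (h : IsBoson A e') (i : I) {n : ℕ} {p : Uq A × Uq A ⊗[𝕂] Uq A}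
    (hp : p ∈ copGraph A (n + 1)) :
    (e' i p.1, (e' i).rTensor (Uq A) p.2) ∈ _root_.copGraph A n := by
  refine copGraph_le_comap (_root_.copGraph A n)
    ((e' i).prodMap ((e' i).rTensor (Uq A))) (fun l hl => ?_) hp
  clear hp p
  induction n generalizing l with
  | zero =>
    obtain ⟨j, rfl⟩ := List.length_eq_one_iff.1 hl
    have hz : (e' i).rTensor (Uq A) (copWord A []) = 0 := by
      rw [copWord, LinearMap.rTensor_tmul, h.one, TensorProduct.zero_tmul]
    rw [LinearMap.prodMap_apply, word_cons, copWord, h.fg_mul, h.rTensor_copMul, hz, word_nil,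
      h.one,
      mul_zero, map_zero, smul_zero, smul_zero, add_zero, add_zero]
    split_ifs
    · exact mem_copGraph []
    · exact zero_mem _
  | succ n ih =>
    obtain ⟨j, l, rfl⟩ := List.exists_cons_of_length_eq_add_one hl
    have hl' : l.length = n + 1 := by simpa using hl
    have h1 := Submodule.smul_mem _ (qv ^ (-(A.d i * A.c i j))) (copMul_mem j (ih l hl'))
    rw [LinearMap.prodMap_apply, word_cons, copWord, h.fg_mul, h.rTensor_copMul]
    have h2 : ((if i = j then word A l else 0, if i = j then copWord A l else 0) :
        Uq A × Uq A ⊗[𝕂] Uq A) ∈ _root_.copGraph A (n + 1) := by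
      split_ifs
      · rw [← hl']; exact mem_copGraph l
      · exact zero_mem _
    exact add_mem h2 h1

theorem sliceR_copMul (φ : Uq A →ₗ[𝕂] 𝕂) (j : I) (z : Uq A ⊗[𝕂] Uq A) :
    sliceR φ (copMul A j z) = fg A j * sliceR φ z +
      Kop A j (sliceR (φ ∘ₗ LinearMap.mulLeft 𝕂 (fg A j)) z) := by
  induction z with
  | zero => simp
  | tmul a b => simp [copMul_tmul]
  | add x y hx hy => simp only [map_add, hx, hy, mul_add]; abel

theorem sliceR_copWord_mem (φ : Uq A →ₗ[𝕂] 𝕂) (l : List I) :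
    sliceR φ (copWord A l) ∈ lenLT A (l.length + 1) := by
  induction l generalizing φ with
  | nil =>
    rw [copWord, sliceR_tmul]
    exact Submodule.smul_mem _ _ (word_mem_lenLT (l := []) (by simp))
  | cons j l ih =>
    rw [copWord, sliceR_copMul]
    exact add_mem (fg_mul_mem_lenLT j (ih φ)) (lenLT_mono (by simp) (scal_mem_lenLT _ (ih _)))

theorem sliceR_copWord_mem_of_one {φ : Uq A →ₗ[𝕂] 𝕂} (hφ : φ 1 = 0) (l : List I) :
    sliceR φ (copWord A l) ∈ lenLT A l.length := by
  induction l with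
  | nil => rw [copWord, sliceR_tmul, hφ, zero_smul]; exact zero_mem _
  | cons j l ih =>
    rw [copWord, sliceR_copMul]
    exact add_mem (fg_mul_mem_lenLT j ih) (scal_mem_lenLT _ (sliceR_copWord_mem _ l))

theorem sliceR_counit_copWord (l : List I) :
    sliceR (counit A).toLinearMap (copWord A l) = word A l := by
  induction l with
  | nil => rw [copWord, sliceR_tmul]; simp [word_nil]
  | cons j l ih =>
    have : (counit A).toLinearMap ∘ₗ LinearMap.mulLeft 𝕂 (fg A j) = 0 := by
      ext x; exact counit_fg_mul j x
    have h0 : sliceR (0 : Uq A →ₗ[𝕂] 𝕂) (copWord A l) = 0 := by simp [sliceR]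
    rw [copWord, sliceR_copMul, ih, this, h0, map_zero, add_zero, word_cons]

theorem sliceL_counit_copWord (l : List I) :
    sliceL (counit A).toLinearMap (copWord A l) = word A l := by
  induction l with
  | nil => rw [copWord, sliceL_tmul]; simp [word_nil]
  | cons j l ih =>
    have : ∀ z : Uq A ⊗[𝕂] Uq A, sliceL (counit A).toLinearMap (copMul A j z) =
        fg A j * sliceL (counit A).toLinearMap z := by
      intro z
      induction z with
      | zero => simp
      | tmul a b => simp [copMul_tmul, counit_fg, Kop, counit_scal]
      | add x y hx hy => simp only [map_add, hx, hy, mul_add]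
    rw [copWord, this, ih, word_cons]

/-- The diagonal operator with eigenvalues `(-1)^{ht β} q^{-(β, β)/2 + (ρ, β)}`. -/
def antipodeScal (A : GCM I) : Uq A →ₗ[𝕂] Uq A := scal A fun β => (-1) ^ ht β * qv ^ (-gexp A β)

theorem antipodeScal_fg_mul (j : I) (x : Uq A) :
    antipodeScal A (fg A j * x) = -(fg A j * antipodeScal A (Kop A j x)) := by
  rw [antipodeScal, scal_fg_mul, Kop, scal_scal, ← Uq.mul_neg, ← Uq.neg_one_smul, ← scal_smul]
  congr 3
  ext β
  rw [map_add, ht_sr, gexp_sr_add, neg_add, zpow_add₀ qv_ne_zero,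
    zpow_add₀ (neg_ne_zero.2 one_ne_zero), zpow_one]
  ring

/-- The diagonal operator with eigenvalues `q^{-(β, β)/2 + (ρ, β)}`. -/
def rhoScal (A : GCM I) : Uq A →ₗ[𝕂] Uq A := scal A fun β => qv ^ (-gexp A β)

theorem rhoScal_fg_mul (j : I) (x : Uq A) :
    rhoScal A (fg A j * x) = fg A j * rhoScal A (Kop A j x) := by
  rw [rhoScal, scal_fg_mul, Kop, scal_scal]
  congr 3
  ext β
  rw [gexp_sr_add, neg_add, zpow_add₀ qv_ne_zero]

/-- The diagonal operator with eigenvalues `(-1)^{ht β}`. -/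
def signScal (A : GCM I) : Uq A →ₗ[𝕂] Uq A := scal A fun β => (-1) ^ ht β

theorem signScal_fg_mul (j : I) (x : Uq A) :
    signScal A (fg A j * x) = -(fg A j * signScal A x) := by
  rw [signScal, scal_fg_mul, ← Uq.mul_neg, ← Uq.neg_one_smul, ← scal_smul]
  congr 3
  ext β
  rw [map_add, ht_sr, zpow_add₀ (neg_ne_zero.2 one_ne_zero), zpow_one]

/-- Convolution of an antipode with the identity. -/
def convLeft (A : GCM I) : Uq A ⊗[𝕂] Uq A →ₗ[𝕂] Uq A :=
  LinearMap.mul' 𝕂 (Uq A) ∘ₗ (rev A ∘ₗ antipodeScal A).rTensor (Uq A)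

/-- The opposite convolution of an antipode with the identity, up to a diagonal operator. -/
def convRight (A : GCM I) : Uq A ⊗[𝕂] Uq A →ₗ[𝕂] Uq A :=
  LinearMap.mul' 𝕂 (Uq A) ∘ₗ TensorProduct.map (rev A ∘ₗ signScal A) (rhoScal A) ∘ₗ
    (TensorProduct.comm 𝕂 (Uq A) (Uq A)).toLinearMap

theorem convLeft_tmul (a b : Uq A) : convLeft A (a ⊗ₜ b) = rev A (antipodeScal A a) * b := rfl

theorem convRight_tmul (a b : Uq A) :
    convRight A (a ⊗ₜ b) = rev A (signScal A b) * rhoScal A a := rfl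

theorem convLeft_copMul (j : I) (z : Uq A ⊗[𝕂] Uq A) : convLeft A (copMul A j z) = 0 := by
  induction z with
  | zero => simp
  | tmul a b =>
    rw [copMul_tmul, map_add, convLeft_tmul, convLeft_tmul, antipodeScal_fg_mul, map_neg, rev_mul,
      rev_fg, Uq.neg_mul, mul_assoc, neg_add_cancel]
  | add x y hx hy => rw [map_add, map_add, hx, hy, add_zero]

theorem convRight_copMul (j : I) (z : Uq A ⊗[𝕂] Uq A) : convRight A (copMul A j z) = 0 := by
  induction z with
  | zero => simp
  | tmul a b =>
    rw [copMul_tmul, map_add, convRight_tmul, convRight_tmul, signScal_fg_mul, map_neg, rev_mul,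
      rev_fg, Uq.neg_mul, rhoScal_fg_mul, mul_assoc, add_neg_cancel]
  | add x y hx hy => rw [map_add, map_add, hx, hy, add_zero]

end Coproduct

section Primitive

variable {A : GCM I} {e' : I → Module.End 𝕂 (Uq A)}

theorem copGraph_ext {n : ℕ} {V : Type*} [AddCommMonoid V] [Module 𝕂 V]
    {f g : Uq A × Uq A ⊗[𝕂] Uq A →ₗ[𝕂] V}
    (h : ∀ l : List I, l.length = n → f (word A l, copWord A l) = g (word A l, copWord A l))
    {p : Uq A × Uq A ⊗[𝕂] Uq A} (hp : p ∈ copGraph A n) : f p = g p := by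
  refine LinearMap.eqOn_span ?_ hp
  rintro _ ⟨l, hl, rfl⟩
  exact h l hl

theorem copGraph_sliceR {n : ℕ} {u : Uq A} {z : Uq A ⊗[𝕂] Uq A} (hp : (u, z) ∈ copGraph A n) :
    sliceR (counit A).toLinearMap z = u :=
  copGraph_ext (f := sliceR (counit A).toLinearMap ∘ₗ LinearMap.snd 𝕂 _ _)
    (g := LinearMap.fst 𝕂 _ _) (fun l _ => sliceR_counit_copWord l) hp

theorem copGraph_sliceL {n : ℕ} {u : Uq A} {z : Uq A ⊗[𝕂] Uq A} (hp : (u, z) ∈ copGraph A n) :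
    sliceL (counit A).toLinearMap z = u :=
  copGraph_ext (f := sliceL (counit A).toLinearMap ∘ₗ LinearMap.snd 𝕂 _ _)
    (g := LinearMap.fst 𝕂 _ _) (fun l _ => sliceL_counit_copWord l) hp

theorem copGraph_counit {n : ℕ} {u : Uq A} {z : Uq A ⊗[𝕂] Uq A}
    (hp : (u, z) ∈ copGraph A (n + 1)) : counit A u = 0 :=
  copGraph_ext (f := (counit A).toLinearMap ∘ₗ LinearMap.fst 𝕂 _ _) (g := 0) (fun l hl => by
    obtain ⟨j, l, rfl⟩ := List.exists_cons_of_length_eq_add_one hl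
    change counit A (word A (j :: l)) = 0
    rw [word_cons, counit_fg_mul]) hp

theorem copGraph_convLeft {n : ℕ} {u : Uq A} {z : Uq A ⊗[𝕂] Uq A}
    (hp : (u, z) ∈ copGraph A (n + 1)) : convLeft A z = 0 :=
  copGraph_ext (f := convLeft A ∘ₗ LinearMap.snd 𝕂 _ _) (g := 0) (fun l hl => by
    obtain ⟨j, l, rfl⟩ := List.exists_cons_of_length_eq_add_one hl
    exact convLeft_copMul j _) hp

theorem copGraph_convRight {n : ℕ} {u : Uq A} {z : Uq A ⊗[𝕂] Uq A}
    (hp : (u, z) ∈ copGraph A (n + 1)) : convRight A z = 0 :=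
  copGraph_ext (f := convRight A ∘ₗ LinearMap.snd 𝕂 _ _) (g := 0) (fun l hl => by
    obtain ⟨j, l, rfl⟩ := List.exists_cons_of_length_eq_add_one hl
    exact convRight_copMul j _) hp

theorem sliceR_rTensor (φ : Uq A →ₗ[𝕂] 𝕂) (f : Module.End 𝕂 (Uq A)) (z : Uq A ⊗[𝕂] Uq A) :
    f (sliceR φ z) = sliceR φ (f.rTensor (Uq A) z) := by
  induction z with
  | zero => simp
  | tmul a b => simp
  | add x y hx hy => simp only [map_add, hx, hy]

theorem copGraph_primitive (h : IsBoson A e') {n : ℕ}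
    (hN : ∀ s ∈ lenLT A (n + 1), (∀ i, e' i s = 0) → s = counit A s • 1)
    (hD : ∀ z, (0, z) ∈ copGraph A n → z = 0) {u : Uq A} {z : Uq A ⊗[𝕂] Uq A}
    (hp : (u, z) ∈ copGraph A (n + 1)) (hu : ∀ i, e' i u = 0) : z = u ⊗ₜ 1 + 1 ⊗ₜ u := by
  have hz : ∀ i, (e' i).rTensor (Uq A) z = 0 := by
    intro i
    have h1 := h.copGraph i hp
    rw [hu] at h1
    exact hD _ h1
  have hs : ∀ φ : Uq A →ₗ[𝕂] 𝕂, φ 1 = 0 → sliceR φ z = φ u • 1 := by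
    intro φ hφ
    have h1 : sliceR φ z ∈ lenLT A (n + 1) :=
      copGraph_le_comap (lenLT A (n + 1)) (sliceR φ ∘ₗ LinearMap.snd 𝕂 _ _) (fun l hl => by
        rw [← hl]
        exact sliceR_copWord_mem_of_one hφ l) hp
    rw [hN _ h1 fun i => by rw [sliceR_rTensor, hz, map_zero], ← AlgHom.toLinearMap_apply,
      sliceR_sliceL_comm, copGraph_sliceL hp]
  refine eq_of_sliceR fun φ => ?_
  have hφ := hs (φ - φ 1 • (counit A).toLinearMap) (by simp)
  have hsub : sliceR φ z = sliceR (φ - φ 1 • (counit A).toLinearMap) z +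
      φ 1 • sliceR (counit A).toLinearMap z := by
    clear hφ hs hz hp
    induction z with
    | zero => simp
    | tmul a b =>
      rw [sliceR_tmul, sliceR_tmul, sliceR_tmul, smul_smul, ← add_smul]
      simp
    | add x y hx hy => simp only [map_add, hx, hy, smul_add]; abel
  rw [hsub, hφ, copGraph_sliceR hp, map_add, sliceR_tmul, sliceR_tmul, LinearMap.sub_apply,
    LinearMap.smul_apply, AlgHom.toLinearMap_apply, copGraph_counit hp, smul_zero, sub_zero,
    add_comm]

theorem exists_mem_copGraph {n : ℕ} {β : I →₀ ℤ} {u : Uq A}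
    (hu : u ∈ Submodule.span 𝕂 {y | ∃ l : List I, (lwt l = β ∧ l.length = n) ∧ y = word A l}) :
    ∃ z, (u, z) ∈ copGraph A n := by
  induction hu using Submodule.span_induction with
  | mem x hx =>
    obtain ⟨l, ⟨-, rfl⟩, rfl⟩ := hx
    exact ⟨_, mem_copGraph l⟩
  | zero => exact ⟨0, zero_mem _⟩
  | add x y _ _ hx hy =>
    obtain ⟨z, hz⟩ := hx
    obtain ⟨w, hw⟩ := hy
    exact ⟨z + w, add_mem hz hw⟩
  | smul c x _ hx =>
    obtain ⟨z, hz⟩ := hx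
    exact ⟨c • z, Submodule.smul_mem _ c hz⟩

theorem eq_zero_of_primitive (h : IsBoson A e') {n : ℕ}
    (hN : ∀ s ∈ lenLT A (n + 1), (∀ i, e' i s = 0) → s = counit A s • 1)
    {l : List I} (hl : l ≠ []) {u : Uq A} (hh : IsHomog A (lwt l) u) (hlen : u ∈ lenLT A (n + 2))
    (hp : (u, u ⊗ₜ 1 + 1 ⊗ₜ u) ∈ copGraph A (n + 1)) (hu : ∀ i, e' i u = 0) : u = 0 := by
  have h1 := copGraph_convLeft hp
  have h2 := copGraph_convRight hp
  rw [map_add, convLeft_tmul, convLeft_tmul, antipodeScal, scal_one, hh, map_zero, gexp_zero,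
    zpow_zero, neg_zero, zpow_zero, mul_one, mul_one, one_smul, rev_one, one_mul, map_smul] at h1
  rw [map_add, convRight_tmul, convRight_tmul, signScal, rhoScal, scal_one, scal_one, hh, hh,
    map_zero, gexp_zero, zpow_zero, neg_zero, zpow_zero, one_smul, mul_one, rev_one,
    one_mul, map_smul] at h2
  set s : 𝕂 := (-1) ^ ht (lwt l) with hs
  have hss : s * s = 1 := by
    rw [hs, ← mul_zpow, neg_one_mul, neg_neg, one_zpow]
  set t : 𝕂 := qv ^ (-gexp A (lwt l)) with ht'
  have h3 : (1 - t * t) • u = 0 := by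
    have h4 := congrArg (fun x => (s * t * s) • x) h2
    have h5 : (s * t * s) • s • rev A u = -u := by
      rw [smul_smul, mul_assoc (s * t), hss, mul_one]
      exact eq_neg_of_add_eq_zero_left h1
    simp only [smul_add, h5, smul_zero, smul_smul] at h4
    rw [mul_right_comm s t s, hss, one_mul] at h4
    rw [Uq.sub_smul, one_smul, ← neg_eq_zero, neg_sub, sub_eq_add_neg]
    exact h4
  rcases smul_eq_zero.1 h3 with h4 | h4
  · have h5 : qv ^ (-gexp A (lwt l) + -gexp A (lwt l)) = 1 := by
      rw [zpow_add₀ qv_ne_zero]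
      exact (sub_eq_zero.1 h4).symm
    have h6 := qv_zpow_eq_one h5
    obtain ⟨i, hi⟩ := exists_rf_pos A hl (by omega)
    refine eq_zero_of_rf_pos h hh (hu i) ?_ hi
    rw [hN _ (rder_mem_lenLT h i hlen) fun j => by rw [h.rder_comm, hu, map_zero], counit_rder h,
      hu, map_zero, zero_smul]
  · exact h4

theorem eq_counit_of_mem_lenLT_one {s : Uq A} (hs : s ∈ lenLT A 1) : s = counit A s • 1 := by
  refine LinearMap.eqOn_span (f := LinearMap.id)
    (g := (LinearMap.toSpanSingleton 𝕂 (Uq A) 1) ∘ₗ (counit A).toLinearMap) ?_ hs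
  rintro _ ⟨l, hl, rfl⟩
  obtain rfl : l = [] := List.length_eq_zero_iff.1 (by omega)
  simp [word_nil]

theorem eq_counit_and_copGraph_zero (h : IsBoson A e') (n : ℕ) :
    (∀ s ∈ lenLT A (n + 1), (∀ i, e' i s = 0) → s = counit A s • 1) ∧
      ∀ z, (0, z) ∈ copGraph A n → z = 0 := by
  induction n with
  | zero =>
    constructor
    · exact fun s hs _ => eq_counit_of_mem_lenLT_one hs
    · intro z hz
      have : ∀ p ∈ copGraph A 0, p.2 = counit A p.1 • (1 ⊗ₜ 1 : Uq A ⊗[𝕂] Uq A) := by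
        intro p hp
        refine copGraph_ext (f := LinearMap.snd 𝕂 _ _)
          (g := (LinearMap.toSpanSingleton 𝕂 _ (1 ⊗ₜ 1 : Uq A ⊗[𝕂] Uq A)) ∘ₗ
            (counit A).toLinearMap ∘ₗ LinearMap.fst 𝕂 _ _) (fun l hl => ?_) hp
        obtain rfl := List.length_eq_zero_iff.1 hl
        simp [word_nil, copWord]
      simpa using this _ hz
  | succ n ih =>
    obtain ⟨hN, hD⟩ := ih
    constructor
    · intro s hs hk
      rw [← comp_zero]
      refine eq_comp_zero fun β hβ => ?_
      have hk' : ∀ i, e' i (comp A β s) = 0 := fun i => by rw [comp, h.scal, hk, map_zero]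
      have hc : counit A (comp A β s) = 0 := by
        rw [comp, counit_scal, if_neg (Ne.symm hβ), zero_mul]
      have hmem := comp_mem_span (β := β) hs
      by_cases hex : ∃ l : List I, lwt l = β ∧ l.length < n + 1 + 1
      · obtain ⟨l₀, rfl, hl₀⟩ := hex
        have hlen : ∀ l : List I, lwt l = lwt l₀ → l.length = l₀.length := by
          intro l hl
          have := congrArg ht hl
          rw [ht_lwt, ht_lwt] at this
          exact_mod_cast this
        rcases Nat.lt_succ_iff_lt_or_eq.1 hl₀ with hlt | heq
        · rw [hN _ _ hk', hc, zero_smul]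
          refine Submodule.span_mono ?_ hmem
          rintro _ ⟨l, ⟨hl, -⟩, rfl⟩
          exact ⟨l, by rw [hlen l hl]; exact hlt, rfl⟩
        · obtain ⟨z, hz⟩ := exists_mem_copGraph (n := n + 1) (β := lwt l₀)
            (u := comp A (lwt l₀) s) (by
              refine Submodule.span_mono ?_ hmem
              rintro _ ⟨l, ⟨hl, -⟩, rfl⟩
              exact ⟨l, ⟨hl, (hlen l hl).trans heq⟩, rfl⟩)
          have hz' := copGraph_primitive h hN hD hz hk'
          subst hz'
          refine eq_zero_of_primitive h hN ?_ (isHomog_comp _ _) (scal_mem_lenLT _ hs) hz hk'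
          rintro rfl
          simp at heq
      · rw [← Submodule.mem_bot 𝕂]
        convert hmem
        symm
        rw [Submodule.span_eq_bot]
        rintro _ ⟨l, hl, rfl⟩
        exact absurd ⟨l, hl⟩ hex
    · intro z hz
      have := copGraph_primitive h hN hD hz fun i => map_zero _
      simpa using this

/-- The elements killed by all `e_i'` are the scalars. -/
theorem IsBoson.eq_counit_smul_one (h : IsBoson A e') {u : Uq A} (hu : ∀ i, e' i u = 0) :
    u = counit A u • 1 := by
  obtain ⟨n, hn⟩ := exists_mem_lenLT u
  exact (eq_counit_and_copGraph_zero h n).1 u (lenLT_mono (Nat.le_succ n) hn) hu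

end Primitive

section Pairing

variable {A : GCM I} {e' : I → Module.End 𝕂 (Uq A)} {E : Uq A →ₐ[𝕂] Module.End 𝕂 (Uq A)}

/-- The functional `x ↦ ε (E(x) v)`, where `ε` is the augmentation. -/
def evalFunctional (E : Uq A →ₐ[𝕂] Module.End 𝕂 (Uq A)) (v : Uq A) : Uq A →ₗ[𝕂] 𝕂 :=
  (counit A).toLinearMap ∘ₗ LinearMap.applyₗ v ∘ₗ E.toLinearMap

theorem evalFunctional_apply (v x : Uq A) : evalFunctional E v x = counit A (E x v) := rfl

theorem evalFunctional_mul_fg (hE : ∀ i, E (fg A i) = e' i) (i : I) (v x : Uq A) :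
    evalFunctional E v (x * fg A i) = evalFunctional E (e' i v) x := by
  rw [evalFunctional_apply, map_mul, hE, Module.End.mul_apply, evalFunctional_apply]

theorem evalFunctional_fg_mul (h : IsBoson A e') (hE : ∀ i, E (fg A i) = e' i) (i : I)
    (v x : Uq A) : evalFunctional E (fg A i * v) (rev A x) =
      evalFunctional E v (rev A (e' i x)) := by
  induction x using Uq.induction_cons generalizing v with
  | one => rw [h.one, rev_one, map_zero, map_zero, evalFunctional_apply, map_one,
      Module.End.one_apply, counit_fg_mul]
  | fg_mul j x hx =>
    have key : ∀ u : Uq A, evalFunctional E (e' j (fg A i * u)) (rev A x) =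
        (if j = i then evalFunctional E u (rev A x) else 0) +
          qv ^ (-(A.d j * A.c j i)) * evalFunctional E (fg A i * e' j u) (rev A x) := by
      intro u
      rw [h.fg_mul, evalFunctional_apply, map_add, map_add, map_smul, map_smul, smul_eq_mul]
      split_ifs
      · rfl
      · rw [map_zero, map_zero]; rfl
    rw [rev_mul, rev_fg, evalFunctional_mul_fg hE, key, hx, h.fg_mul, map_add, map_add, map_smul,
      map_smul, rev_mul, rev_fg, evalFunctional_mul_fg hE, smul_eq_mul, A.dsymm i j]
    by_cases hij : i = j
    · rw [if_pos hij, if_pos hij.symm]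
    · rw [if_neg hij, if_neg (Ne.symm hij), map_zero, map_zero]
  | add x y hx hy => simp only [map_add, hx, hy]
  | smul s x hx => simp only [map_smul, hx]

theorem evalFunctional_scal (h : IsBoson A e') (hE : ∀ i, E (fg A i) = e' i)
    (c : (I →₀ ℤ) → 𝕂) (v x : Uq A) :
    evalFunctional E v (scal A c x) = evalFunctional E (scal A c v) x := by
  suffices H : ∀ x, evalFunctional E v (rev A (scal A c x)) =
      evalFunctional E (scal A c v) (rev A x) by
    have := H (rev A x)
    rwa [rev_scal, rev_rev] at this
  intro x
  induction x using Uq.induction_cons generalizing v c with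
  | one =>
    rw [scal_one, map_smul, rev_one, map_smul, evalFunctional_apply, evalFunctional_apply, map_one,
      Module.End.one_apply, Module.End.one_apply, counit_scal, smul_eq_mul]
  | fg_mul j x hx =>
    rw [scal_fg_mul, rev_mul, rev_mul, rev_fg, evalFunctional_mul_fg hE, evalFunctional_mul_fg hE,
      hx, h.scal]
  | add x y hx hy => simp only [map_add, hx, hy]
  | smul s x hx => simp only [map_smul, hx]

theorem evalFunctional_one (h : IsBoson A e') (hE : ∀ i, E (fg A i) = e' i) (x : Uq A) :
    evalFunctional E 1 (rev A x) = counit A x := by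
  induction x using Uq.induction_cons with
  | one => rw [rev_one, evalFunctional_apply, map_one E, Module.End.one_apply]
  | fg_mul j x hx =>
    rw [rev_mul, rev_fg, evalFunctional_mul_fg hE, h.one, counit_fg_mul, evalFunctional_apply,
      map_zero, map_zero]
  | add x y hx hy => simp only [map_add, hx, hy]
  | smul s x hx => simp only [map_smul, hx]

/-- Nondegeneracy of the bilinear form `(w, v) ↦ ε (E(rev w) v)`. -/
theorem eq_zero_of_evalFunctional (h : IsBoson A e') (hE : ∀ i, E (fg A i) = e' i) {x : Uq A}
    (hx : ∀ v, evalFunctional E v x = 0) : x = 0 := by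
  suffices H : ∀ n, ∀ w ∈ lenLT A n, (∀ v, evalFunctional E v (rev A w) = 0) → w = 0 by
    obtain ⟨n, hn⟩ := exists_mem_lenLT (rev A x)
    have h1 := H n _ hn fun v => by rw [rev_rev]; exact hx v
    rw [← rev_rev A x, h1, map_zero]
  intro n
  induction n with
  | zero => intro w hw _; rw [lenLT_zero] at hw; simpa using hw
  | succ n ih =>
    intro w hw hv
    rw [h.eq_counit_smul_one (u := w), ← evalFunctional_one h hE, hv, zero_smul]
    exact fun i => ih _ (h.mem_lenLT i hw) fun v => by rw [← evalFunctional_fg_mul h hE, hv]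

theorem E_word_mem_lenLT (h : IsBoson A e') (hE : ∀ i, E (fg A i) = e' i) (l : List I) {m : ℕ}
    {u : Uq A} (hu : u ∈ lenLT A m) : E (word A l) u ∈ lenLT A (m - l.length) := by
  induction l with
  | nil => rw [word_nil, map_one]; exact hu
  | cons i l ih =>
    rw [word_cons, map_mul, hE, Module.End.mul_apply, List.length_cons, ← Nat.sub_sub]
    generalize m - l.length = k at ih
    cases k with
    | zero =>
      rw [lenLT_zero, Submodule.mem_bot] at ih
      rw [ih, map_zero]
      exact zero_mem _
    | succ k => exact h.mem_lenLT i ih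

open Classical in
/-- The projection onto the components of height at least `n`. -/
def htGE (A : GCM I) (n : ℕ) : Uq A →ₗ[𝕂] Uq A :=
  scal A fun β => if (n : ℤ) ≤ ht β then 1 else 0

theorem E_htGE_apply (h : IsBoson A e') (hE : ∀ i, E (fg A i) = e' i) {n : ℕ} {u : Uq A}
    (hu : u ∈ lenLT A (n + 1)) (x : Uq A) :
    E (htGE A n x) u = evalFunctional E u (htGE A n x) • 1 := by
  rw [evalFunctional_apply]
  apply eq_counit_of_mem_lenLT_one
  induction x using Uq.induction with
  | word l =>
    rw [htGE, scal_word, ht_lwt]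
    split_ifs with hl
    · rw [one_smul]
      exact lenLT_mono (by omega) (E_word_mem_lenLT h hE l hu)
    · rw [zero_smul, map_zero]; exact zero_mem _
  | add x y hx hy => rw [map_add, map_add]; exact add_mem hx hy
  | smul c x hx => rw [map_smul, map_smul]; exact Submodule.smul_mem _ c hx

theorem exists_htGE_eq_zero (x : Uq A) : ∃ n, ∀ m, n ≤ m → htGE A m x = 0 := by
  obtain ⟨n, hn⟩ := exists_mem_lenLT x
  refine ⟨n, fun m hm => ?_⟩
  refine LinearMap.eqOn_span (f := htGE A m) (g := 0) ?_ hn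
  rintro _ ⟨l, hl, rfl⟩
  rw [htGE, scal_word, ht_lwt, if_neg (by omega), zero_smul, LinearMap.zero_apply]

/-- The map `y ⊗ x ↦ L(y) ∘ E(x)`. -/
def PsiRev (A : GCM I) (E : Uq A →ₐ[𝕂] Module.End 𝕂 (Uq A)) :
    Uq A ⊗[𝕂] Uq A →ₗ[𝕂] Module.End 𝕂 (Uq A) :=
  TensorProduct.lift ((LinearMap.mul 𝕂 (Module.End 𝕂 (Uq A))).compl₁₂
    (LinearMap.mul 𝕂 (Uq A)) E.toLinearMap)

theorem PsiRev_tmul_apply (y x u : Uq A) : PsiRev A E (y ⊗ₜ x) u = y * E x u := rfl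

theorem PsiRev_htGE_apply (h : IsBoson A e') (hE : ∀ i, E (fg A i) = e' i) {n : ℕ} {u : Uq A}
    (hu : u ∈ lenLT A (n + 1)) (z : Uq A ⊗[𝕂] Uq A) :
    PsiRev A E ((htGE A n).lTensor (Uq A) z) u =
      sliceR (evalFunctional E u) ((htGE A n).lTensor (Uq A) z) := by
  induction z with
  | zero => simp
  | tmul y x =>
    rw [LinearMap.lTensor_tmul, PsiRev_tmul_apply, sliceR_tmul, E_htGE_apply h hE hu, mul_smul_comm,
      mul_one]
  | add x y hx hy => rw [map_add, map_add, map_add, LinearMap.add_apply, hx, hy]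

theorem eq_of_sliceL {F M N : Type*} [Field F] [AddCommGroup M] [Module F M] [AddCommGroup N]
    [Module F N] {z w : M ⊗[F] N} (h : ∀ φ, sliceL φ z = sliceL φ w) : z = w := by
  have key : ∀ (φ : M →ₗ[F] F) (y : M ⊗[F] N),
      sliceR φ (TensorProduct.comm F M N y) = sliceL φ y := by
    intro φ y
    induction y with
    | zero => simp
    | tmul a b => simp
    | add x y hx hy => simp only [map_add, hx, hy]
  refine (TensorProduct.comm F M N).injective (eq_of_sliceR fun φ => ?_)
  rw [key, key, h]

theorem sliceL_lTensor (φ : Uq A →ₗ[𝕂] 𝕂) (f : Uq A →ₗ[𝕂] Uq A) (z : Uq A ⊗[𝕂] Uq A) :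
    sliceL φ (f.lTensor (Uq A) z) = f (sliceL φ z) := by
  induction z with
  | zero => simp
  | tmul a b => simp
  | add x y hx hy => simp only [map_add, hx, hy]

theorem htGE_succ (n : ℕ) (x : Uq A) : htGE A n x = htGE A (n + 1) x +
    scal A (fun β => if ht β = (n : ℤ) then 1 else 0) x := by
  induction x using Uq.induction with
  | word l =>
    rw [htGE, htGE, scal_word, scal_word, scal_word, ← add_smul, ht_lwt]
    congr 1
    push_cast
    split_ifs <;> first | omega | simp
  | add x y hx hy => simp only [map_add, hx, hy]; abel
  | smul c x hx => simp only [map_smul, hx, smul_add]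

theorem eq_neg_one_smul_of_add_eq_zero {F M : Type*} [Ring F] [AddCommMonoid M] [Module F M]
    {x y : M} (h : x + y = 0) : x = (-1 : F) • y := by
  have hy : y + (-1 : F) • y = 0 := by
    nth_rw 1 [← one_smul F y]
    rw [← add_smul, add_neg_cancel, zero_smul]
  rw [← add_zero x, ← hy, ← add_assoc, h, zero_add]

theorem injective_of_map_eq_zero {F M N : Type*} [Ring F] [AddCommMonoid M] [Module F M]
    [AddCommMonoid N] [Module F N] {f : M →ₗ[F] N} (h : ∀ z, f z = 0 → z = 0) :
    Function.Injective f := by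
  intro z w hzw
  have h0 : f (z + (-1 : F) • w) = 0 := by
    rw [map_add, map_smul, hzw]
    nth_rw 1 [← one_smul F (f w)]
    rw [← add_smul, add_neg_cancel, zero_smul]
  rw [eq_neg_one_smul_of_add_eq_zero (F := F) (h _ h0), smul_smul, neg_one_mul, neg_neg, one_smul]

theorem PsiRev_injective (h : IsBoson A e') (hE : ∀ i, E (fg A i) = e' i) :
    Function.Injective (PsiRev A E) := by
  refine injective_of_map_eq_zero fun z hz => ?_
  have hn : ∀ n, (htGE A n).lTensor (Uq A) z = z := by
    intro n
    induction n with
    | zero =>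
      have : htGE A 0 = LinearMap.id := Uq.linearMap_ext fun l => by
        rw [htGE, scal_word, ht_lwt, if_pos (by omega), one_smul, LinearMap.id_apply]
      rw [this, LinearMap.lTensor_id, LinearMap.id_apply]
    | succ n ih =>
      refine eq_of_sliceL fun ψ => ?_
      have hR : ∀ u ∈ lenLT A (n + 1), sliceR (evalFunctional E u) z = 0 := by
        intro u hu
        have := PsiRev_htGE_apply h hE hu z
        rw [ih, hz] at this
        exact this.symm
      have hx : scal A (fun β => if ht β = (n : ℤ) then 1 else 0) (sliceL ψ z) = 0 := by
        refine eq_zero_of_evalFunctional h hE fun v => ?_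
        rw [evalFunctional_scal h hE, ← sliceR_sliceL_comm, hR, map_zero]
        induction v using Uq.induction with
        | word l =>
          rw [scal_word, ht_lwt]
          split_ifs with hl
          · rw [one_smul]; exact word_mem_lenLT (by omega)
          · rw [zero_smul]; exact zero_mem _
        | add x y hx hy => rw [map_add]; exact add_mem hx hy
        | smul c x hx => rw [map_smul]; exact Submodule.smul_mem _ c hx
      have h1 := sliceL_lTensor ψ (htGE A n) z
      rw [ih, htGE_succ, hx, add_zero] at h1
      rw [sliceL_lTensor, ← h1]
  have hN : ∃ n, ∀ m, n ≤ m → (htGE A m).lTensor (Uq A) z = 0 := by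
    clear hz hn
    induction z with
    | zero => exact ⟨0, fun m _ => map_zero _⟩
    | tmul a b =>
      obtain ⟨n, hn⟩ := exists_htGE_eq_zero b
      exact ⟨n, fun m hm => by rw [LinearMap.lTensor_tmul, hn m hm, TensorProduct.tmul_zero]⟩
    | add x y hx hy =>
      obtain ⟨n, hn⟩ := hx
      obtain ⟨k, hk⟩ := hy
      exact ⟨max n k, fun m hm => by
        rw [map_add, hn m ((le_max_left _ _).trans hm), hk m ((le_max_right _ _).trans hm),
          add_zero]⟩
  obtain ⟨n, hn'⟩ := hN
  rw [← hn n, hn' n le_rfl]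

end Pairing

section Triangular

variable {A : GCM I} {e' : I → Module.End 𝕂 (Uq A)} {E : Uq A →ₐ[𝕂] Module.End 𝕂 (Uq A)}

/-- The operator on `U ⊗ U` multiplying the component of weight `(-β, -γ)` by `c β γ`. -/
def scalTensor (A : GCM I) (c : (I →₀ ℤ) → (I →₀ ℤ) → 𝕂) :
    Uq A ⊗[𝕂] Uq A →ₗ[𝕂] Uq A ⊗[𝕂] Uq A :=
  TensorProduct.lift
    { toFun := fun x => (weightHom A x).coeff.sum fun β v =>
        TensorProduct.mk 𝕂 (Uq A) (Uq A) v ∘ₗ scal A (c β)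
      map_add' := fun x y => by
        rw [map_add, AddMonoidAlgebra.coeff_add, Finsupp.sum_add_index'] <;>
          simp [LinearMap.add_comp]
      map_smul' := fun r x => by
        rw [map_smul, AddMonoidAlgebra.coeff_smul, Finsupp.sum_smul_index' (by simp),
          RingHom.id_apply, Finsupp.smul_sum]
        exact Finset.sum_congr rfl fun β _ => by simp only [map_smul, LinearMap.smul_comp] }

theorem scalTensor_word_tmul (c : (I →₀ ℤ) → (I →₀ ℤ) → 𝕂) (l : List I) (y : Uq A) :
    scalTensor A c (word A l ⊗ₜ y) = word A l ⊗ₜ scal A (c (lwt l)) y := by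
  change ((weightHom A (word A l)).coeff.sum fun β v =>
        TensorProduct.mk 𝕂 (Uq A) (Uq A) v ∘ₗ scal A (c β)) y = _
  rw [weightHom_word, AddMonoidAlgebra.coeff_single, Finsupp.sum_single_index]
  · rfl
  · rw [map_zero, LinearMap.zero_comp]

/-- The span of the tensors whose right factor has length less than `n`. -/
def tensorLT (A : GCM I) (n : ℕ) : Submodule 𝕂 (Uq A ⊗[𝕂] Uq A) :=
  Submodule.span 𝕂 {z | ∃ (l : List I) (y : Uq A), y ∈ lenLT A n ∧ z = word A l ⊗ₜ y}

theorem tmul_mem_tensorLT {n : ℕ} (x : Uq A) {y : Uq A} (hy : y ∈ lenLT A n) :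
    x ⊗ₜ y ∈ tensorLT A n := by
  induction x using Uq.induction with
  | word l => exact Submodule.subset_span ⟨l, y, hy, rfl⟩
  | add x x' hx hx' => rw [TensorProduct.add_tmul]; exact add_mem hx hx'
  | smul c x hx => rw [← TensorProduct.smul_tmul']; exact Submodule.smul_mem _ c hx

theorem tensorLT_le_comap {m n : ℕ} {f : Uq A ⊗[𝕂] Uq A →ₗ[𝕂] Uq A ⊗[𝕂] Uq A}
    (h : ∀ (l : List I), ∀ y ∈ lenLT A m, f (word A l ⊗ₜ y) ∈ tensorLT A n)
    {z : Uq A ⊗[𝕂] Uq A} (hz : z ∈ tensorLT A m) : f z ∈ tensorLT A n := by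
  have : tensorLT A m ≤ (tensorLT A n).comap f := by
    refine Submodule.span_le.2 ?_
    rintro _ ⟨l, y, hy, rfl⟩
    exact h l y hy
  exact this hz

theorem tensorLT_mono {m n : ℕ} (h : m ≤ n) : tensorLT A m ≤ tensorLT A n := by
  refine Submodule.span_mono ?_
  rintro _ ⟨l, y, hy, rfl⟩
  exact ⟨l, y, lenLT_mono h hy, rfl⟩

theorem tensorLT_zero : tensorLT A 0 = ⊥ := by
  rw [tensorLT, Submodule.span_eq_bot]
  rintro _ ⟨l, y, hy, rfl⟩
  rw [lenLT_zero, Submodule.mem_bot] at hy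
  rw [hy, TensorProduct.tmul_zero]

theorem exists_mem_tensorLT (z : Uq A ⊗[𝕂] Uq A) : ∃ n, z ∈ tensorLT A n := by
  induction z with
  | zero => exact ⟨0, zero_mem _⟩
  | tmul x y =>
    obtain ⟨n, hn⟩ := exists_mem_lenLT y
    exact ⟨n, tmul_mem_tensorLT x hn⟩
  | add x y hx hy =>
    obtain ⟨m, hm⟩ := hx
    obtain ⟨n, hn⟩ := hy
    exact ⟨max m n,
      add_mem (tensorLT_mono (le_max_left m n) hm) (tensorLT_mono (le_max_right m n) hn)⟩

/-- The map `x ⊗ y ↦ L(y) ∘ E(x)`. -/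
def PsiOp (A : GCM I) (E : Uq A →ₐ[𝕂] Module.End 𝕂 (Uq A)) :
    Uq A ⊗[𝕂] Uq A →ₗ[𝕂] Module.End 𝕂 (Uq A) :=
  PsiRev A E ∘ₗ (TensorProduct.comm 𝕂 (Uq A) (Uq A)).toLinearMap

theorem PsiOp_tmul_apply (x y u : Uq A) : PsiOp A E (x ⊗ₜ y) u = y * E x u := rfl

theorem PsiMap_tmul_apply (x y u : Uq A) : PsiMap A E (x ⊗ₜ y) u = E x (y * u) := rfl

/-- The operator on `U ⊗ U` describing left multiplication by `e_i'` on the operators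
`L(y) ∘ E(x)`. -/
def bosonTensor (e' : I → Module.End 𝕂 (Uq A)) (i : I) :
    Uq A ⊗[𝕂] Uq A →ₗ[𝕂] Uq A ⊗[𝕂] Uq A :=
  (e' i).lTensor (Uq A) + TensorProduct.map (LinearMap.mulLeft 𝕂 (fg A i)) (Kop A i)

theorem bosonTensor_tmul (i : I) (x y : Uq A) :
    bosonTensor e' i (x ⊗ₜ y) = x ⊗ₜ e' i y + (fg A i * x) ⊗ₜ Kop A i y := rfl

theorem PsiOp_bosonTensor (h : IsBoson A e') (hE : ∀ i, E (fg A i) = e' i) (i : I)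
    (z : Uq A ⊗[𝕂] Uq A) : PsiOp A E (bosonTensor e' i z) = e' i * PsiOp A E z := by
  induction z with
  | zero => rw [map_zero, map_zero, mul_zero]
  | tmul x y =>
    ext u
    rw [bosonTensor_tmul, map_add, LinearMap.add_apply, Module.End.mul_apply, PsiOp_tmul_apply,
      PsiOp_tmul_apply, PsiOp_tmul_apply, h.mul, map_mul, hE, Module.End.mul_apply]
  | add x y hx hy => rw [map_add, map_add, map_add, hx, hy, mul_add]

theorem bosonTensor_mem (h : IsBoson A e') (i : I) {n : ℕ} {z : Uq A ⊗[𝕂] Uq A}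
    (hz : z ∈ tensorLT A n) : bosonTensor e' i z ∈ tensorLT A n := by
  refine tensorLT_le_comap (fun l y hy => ?_) hz
  rw [bosonTensor_tmul]
  exact add_mem (tmul_mem_tensorLT _ (h.mem_lenLT i (lenLT_mono (Nat.le_succ n) hy)))
    (tmul_mem_tensorLT _ (scal_mem_lenLT _ hy))

theorem exists_PsiMap_word_eq (h : IsBoson A e') (hE : ∀ i, E (fg A i) = e' i) (l : List I)
    {n : ℕ} {y : Uq A} (hy : y ∈ lenLT A (n + 1)) : ∃ t ∈ tensorLT A n,
      PsiMap A E (word A l ⊗ₜ y) =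
        PsiOp A E (word A l ⊗ₜ scal A (fun γ => qv ^ (-bil A (lwt l) γ)) y + t) := by
  induction l with
  | nil =>
    refine ⟨0, zero_mem _, ?_⟩
    ext u
    simp only [lwt, List.map_nil, List.sum_nil, map_zero, AddMonoidHom.zero_apply, neg_zero,
      zpow_zero, scal_one_fun]
    rw [add_zero, word_nil, PsiMap_tmul_apply, PsiOp_tmul_apply, map_one, Module.End.one_apply,
      Module.End.one_apply]
  | cons i l ih =>
    obtain ⟨t, ht, hPsi⟩ := ih
    set y' := scal A (fun γ => qv ^ (-bil A (lwt l) γ)) y with hy'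
    have h1 : scal A (fun γ => qv ^ (-bil A (lwt (i :: l)) γ)) y = Kop A i y' := by
      rw [hy', Kop, scal_scal]
      congr 2
      ext γ
      rw [lwt_cons, map_add, AddMonoidHom.add_apply, bil_sr, neg_add, zpow_add₀ qv_ne_zero]
    refine ⟨word A l ⊗ₜ e' i y' + bosonTensor e' i t, add_mem (tmul_mem_tensorLT _
      (h.mem_lenLT i (scal_mem_lenLT _ hy))) (bosonTensor_mem h i ht), ?_⟩
    have h2 : PsiMap A E (word A (i :: l) ⊗ₜ y) = e' i * PsiMap A E (word A l ⊗ₜ y) := by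
      ext u
      rw [Module.End.mul_apply, PsiMap_tmul_apply, PsiMap_tmul_apply, word_cons, map_mul E, hE,
        Module.End.mul_apply]
    rw [h1, h2, hPsi, ← PsiOp_bosonTensor h hE, map_add, bosonTensor_tmul, word_cons]
    congr 1
    abel

theorem exists_PsiMap_eq (h : IsBoson A e') (hE : ∀ i, E (fg A i) = e' i) {n : ℕ}
    {z : Uq A ⊗[𝕂] Uq A} (hz : z ∈ tensorLT A (n + 1)) : ∃ t ∈ tensorLT A n,
      PsiMap A E z = PsiOp A E (scalTensor A (fun β γ => qv ^ (-bil A β γ)) z + t) := by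
  induction hz using Submodule.span_induction with
  | mem z hz =>
    obtain ⟨l, y, hy, rfl⟩ := hz
    rw [scalTensor_word_tmul]
    exact exists_PsiMap_word_eq h hE l hy
  | zero => exact ⟨0, zero_mem _, by simp only [map_zero, add_zero]⟩
  | add z w _ _ hz hw =>
    obtain ⟨t, ht, h1⟩ := hz
    obtain ⟨s, hs, h2⟩ := hw
    refine ⟨t + s, add_mem ht hs, ?_⟩
    rw [map_add, h1, h2, ← map_add, map_add (scalTensor A _), add_add_add_comm]
  | smul c z _ hz =>
    obtain ⟨t, ht, h1⟩ := hz
    refine ⟨c • t, Submodule.smul_mem _ c ht, ?_⟩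
    rw [map_smul, h1, ← map_smul, map_smul (scalTensor A _), smul_add]

theorem scalTensor_mem (c : (I →₀ ℤ) → (I →₀ ℤ) → 𝕂) {n : ℕ} {z : Uq A ⊗[𝕂] Uq A}
    (hz : z ∈ tensorLT A n) : scalTensor A c z ∈ tensorLT A n := by
  refine tensorLT_le_comap (fun l y hy => ?_) hz
  rw [scalTensor_word_tmul]
  exact tmul_mem_tensorLT _ (scal_mem_lenLT _ hy)

theorem scalTensor_inv (z : Uq A ⊗[𝕂] Uq A) : scalTensor A (fun β γ => qv ^ bil A β γ)
    (scalTensor A (fun β γ => qv ^ (-bil A β γ)) z) = z := by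
  induction z with
  | zero => simp only [map_zero]
  | tmul x y =>
    induction x using Uq.induction with
    | word l =>
      rw [scalTensor_word_tmul, scalTensor_word_tmul, scal_scal]
      simp only [← zpow_add₀ qv_ne_zero, add_neg_cancel, zpow_zero, scal_one_fun]
    | add x x' hx hx' => simp only [TensorProduct.add_tmul, map_add, hx, hx']
    | smul c x hx => simp only [← TensorProduct.smul_tmul', map_smul, hx]
  | add x y hx hy => simp only [map_add, hx, hy]

theorem PsiMap_injective (h : IsBoson A e') (hE : ∀ i, E (fg A i) = e' i) :
    Function.Injective (PsiMap A E) := by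
  refine injective_of_map_eq_zero fun z hz => ?_
  obtain ⟨n, hn⟩ := exists_mem_tensorLT z
  induction n with
  | zero => rw [tensorLT_zero] at hn; exact hn
  | succ n ih =>
    refine ih ?_
    obtain ⟨t, ht, h1⟩ := exists_PsiMap_eq h hE hn
    rw [hz] at h1
    have hinj : Function.Injective (PsiOp A E) :=
      (PsiRev_injective h hE).comp (TensorProduct.comm 𝕂 (Uq A) (Uq A)).injective
    have h2 := hinj (h1.symm.trans (map_zero _).symm)
    rw [← scalTensor_inv z, eq_neg_one_smul_of_add_eq_zero (F := 𝕂) h2]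
    exact scalTensor_mem _ (Submodule.smul_mem _ _ ht)

end Triangular

section Range

variable {A : GCM I} {e' : I → Module.End 𝕂 (Uq A)} {E : Uq A →ₐ[𝕂] Module.End 𝕂 (Uq A)}

theorem PsiMap_tmul (x y : Uq A) : PsiMap A E (x ⊗ₜ y) = E x * LinearMap.mul 𝕂 (Uq A) y := rfl

theorem E_mem_Bqg (hE : ∀ i, E (fg A i) = e' i) (x : Uq A) : E x ∈ Bqg A e' := by
  induction x using Uq.induction_cons with
  | one => rw [map_one]; exact one_mem _
  | fg_mul i x hx =>
    rw [map_mul, hE]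
    exact mul_mem (Algebra.subset_adjoin (Or.inr ⟨i, rfl⟩)) hx
  | add x y hx hy => rw [map_add]; exact add_mem hx hy
  | smul c x hx => rw [map_smul]; exact Subalgebra.smul_mem _ hx c

theorem mul_mem_Bqg (y : Uq A) : LinearMap.mul 𝕂 (Uq A) y ∈ Bqg A e' := by
  induction y using Uq.induction_cons with
  | one =>
    convert one_mem (Bqg A e')
    ext u
    exact one_mul u
  | fg_mul i x hx =>
    have : LinearMap.mul 𝕂 (Uq A) (fg A i * x) =
        (LinearMap.mul 𝕂 (Uq A) (fg A i) : Module.End 𝕂 (Uq A)) * LinearMap.mul 𝕂 (Uq A) x := by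
      ext u
      exact mul_assoc _ _ _
    rw [this]
    exact mul_mem (Algebra.subset_adjoin (Or.inl ⟨i, rfl⟩)) hx
  | add x y hx hy => rw [map_add]; exact add_mem hx hy
  | smul c x hx => rw [map_smul]; exact Subalgebra.smul_mem _ hx c

theorem boson_mul_mem_range (hE : ∀ i, E (fg A i) = e' i) (i : I) {a : Module.End 𝕂 (Uq A)}
    (ha : a ∈ LinearMap.range (PsiMap A E)) : e' i * a ∈ LinearMap.range (PsiMap A E) := by
  obtain ⟨z, rfl⟩ := ha
  induction z with
  | zero => rw [map_zero, mul_zero]; exact zero_mem _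
  | tmul x y => exact ⟨(fg A i * x) ⊗ₜ y, by rw [PsiMap_tmul, PsiMap_tmul, map_mul, hE, mul_assoc]⟩
  | add x y hx hy => rw [map_add, mul_add]; exact add_mem hx hy

theorem mulLeft_mul_mem_range (h : IsBoson A e') (hE : ∀ i, E (fg A i) = e' i) (j : I)
    {a : Module.End 𝕂 (Uq A)} (ha : a ∈ LinearMap.range (PsiMap A E)) :
    (LinearMap.mul 𝕂 (Uq A) (fg A j) : Module.End 𝕂 (Uq A)) * a ∈
      LinearMap.range (PsiMap A E) := by
  obtain ⟨z, rfl⟩ := ha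
  induction z with
  | zero => rw [map_zero, mul_zero]; exact zero_mem _
  | tmul x y =>
    induction x using Uq.induction_cons with
    | one =>
      refine ⟨1 ⊗ₜ (fg A j * y), ?_⟩
      ext u
      rw [Module.End.mul_apply, PsiMap_tmul_apply, PsiMap_tmul_apply, map_one, Module.End.one_apply,
        Module.End.one_apply]
      exact mul_assoc _ _ _
    | fg_mul i x hx =>
      have key : (LinearMap.mul 𝕂 (Uq A) (fg A j) : Module.End 𝕂 (Uq A)) *
          PsiMap A E ((fg A i * x) ⊗ₜ y) = qv ^ (A.d i * A.c i j) • (e' i *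
            ((LinearMap.mul 𝕂 (Uq A) (fg A j) : Module.End 𝕂 (Uq A)) * PsiMap A E (x ⊗ₜ y)) +
              (-1 : 𝕂) • if i = j then PsiMap A E (x ⊗ₜ y) else 0) := by
        ext u
        have h1 : (if i = j then PsiMap A E (x ⊗ₜ y) else 0) u =
            if i = j then PsiMap A E (x ⊗ₜ y) u else 0 := by split_ifs <;> rfl
        rw [LinearMap.smul_apply, LinearMap.add_apply, LinearMap.smul_apply, h1,
          Module.End.mul_apply, Module.End.mul_apply, Module.End.mul_apply,
          LinearMap.mul_apply', LinearMap.mul_apply', h.fg_mul, Uq.neg_one_smul,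
          ← sub_eq_add_neg, add_sub_cancel_left, smul_smul,
          ← zpow_add₀ qv_ne_zero, add_neg_cancel, zpow_zero, one_smul,
          PsiMap_tmul_apply, PsiMap_tmul_apply, map_mul E, hE, Module.End.mul_apply]
      rw [key]
      refine Submodule.smul_mem _ _ (add_mem (boson_mul_mem_range hE i hx)
        (Submodule.smul_mem _ _ ?_))
      split_ifs
      · exact LinearMap.mem_range_self _ _
      · exact zero_mem _
    | add x x' hx hx' => rw [TensorProduct.add_tmul, map_add, mul_add]; exact add_mem hx hx'
    | smul c x hx =>
      rw [← TensorProduct.smul_tmul', map_smul, mul_smul_comm]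
      exact Submodule.smul_mem _ c hx
  | add x y hx hy => rw [map_add, mul_add]; exact add_mem hx hy

theorem PsiMap_range (h : IsBoson A e') (hE : ∀ i, E (fg A i) = e' i) :
    LinearMap.range (PsiMap A E) = Subalgebra.toSubmodule (Bqg A e') := by
  apply le_antisymm
  · rintro _ ⟨z, rfl⟩
    induction z with
    | zero => rw [map_zero]; exact zero_mem _
    | tmul x y => exact (Bqg A e').mul_mem (E_mem_Bqg hE x) (mul_mem_Bqg y)
    | add x y hx hy => rw [map_add]; exact add_mem hx hy
  · intro a ha
    have H : ∀ a ∈ Bqg A e', ∀ r ∈ LinearMap.range (PsiMap A E),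
        a * r ∈ LinearMap.range (PsiMap A E) := by
      intro a ha
      induction ha using Algebra.adjoin_induction with
      | mem a ha =>
        intro r hr
        rcases ha with ⟨i, rfl⟩ | ⟨i, rfl⟩
        · exact mulLeft_mul_mem_range h hE i hr
        · exact boson_mul_mem_range hE i hr
      | algebraMap c =>
        intro r hr
        rw [← Algebra.smul_def]
        exact Submodule.smul_mem _ c hr
      | add a b _ _ ha hb => intro r hr; rw [add_mul]; exact add_mem (ha r hr) (hb r hr)
      | mul a b _ _ ha hb => intro r hr; rw [mul_assoc]; exact ha _ (hb r hr)
    have h1 : (1 : Module.End 𝕂 (Uq A)) ∈ LinearMap.range (PsiMap A E) := by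
      refine ⟨1 ⊗ₜ 1, ?_⟩
      ext u
      rw [PsiMap_tmul_apply, map_one, one_mul]
    simpa using H a ha 1 h1

end Range

/-- `Ψ : U_q^-(g) ⊗ U_q^-(g) → B_q(g)`, `Ψ(x ⊗ y) = E(x)·L(y)`, is bijective.
Here `e_i'` is characterized by `e_i'(1) = 0` and
`e_i'(f_j u) = δ_{ij} u + q^{-(α_i,α_j)} f_j e_i'(u)`, and `E` is the algebra homomorphism
with `E(f_i) = e_i'`.  Bijectivity onto `B_q(g)` is expressed as: `Ψ` is injective and its
range is `B_q(g)`. -/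
theorem statement0 (A : GCM I) (e' : I → Module.End 𝕂 (Uq A))
    (he'one : ∀ i, e' i 1 = 0)
    (he'f : ∀ i j u, e' i (fg A j * u) =
      (if i = j then u else 0) + qv ^ (-(A.d i * A.c i j)) • (fg A j * e' i u))
    (E : Uq A →ₐ[𝕂] Module.End 𝕂 (Uq A))
    (hE : ∀ i, E (fg A i) = e' i) :
    Function.Injective (PsiMap A E) ∧
      LinearMap.range (PsiMap A E) = Subalgebra.toSubmodule (Bqg A e') := by
  have h : IsBoson A e' := ⟨he'one, he'f⟩
  exact ⟨PsiMap_injective h hE, PsiMap_range h hE⟩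

end
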